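/- arXiv:1702.08179 — 2 statements merged into one kernel-verified Lean document; each statement's English description precedes it below -/
import Mathlib

section
/- One-sided fourth-order bound for the first discrete eigenvalue: let λ₁ be the smallest eigenvalue of the clamped biharmonic operator on [0,1]. There exists a constant C > 0 such that for every integer N ≥ 2 (h = 1/N), the largest eigenvalue μ_{h,1} of the matrix K^h satisfies 1/μ_{h,1} ≤ λ₁ + C·h⁴; equivalently, the smallest eigenvalue λ_{h,1} of the discrete biharmonic operator satisfies λ_{h,1} ≤ λ₁ + C·h⁴. -/
open Set

/-- `lam` is an eigenvalue of the clamped biharmonic operator on `[0,1]`. -/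
def IsClampedBiharmonicEV (lam : ℝ) : Prop :=
  ∃ φ : ℝ → ℝ, ContDiff ℝ 4 φ ∧ (∃ x ∈ Set.Icc (0:ℝ) 1, φ x ≠ 0) ∧
    (∀ x ∈ Set.Icc (0:ℝ) 1, iteratedDeriv 4 φ x = lam * φ x) ∧
    φ 0 = 0 ∧ deriv φ 0 = 0 ∧ φ 1 = 0 ∧ deriv φ 1 = 0

/-- Green's kernel of the clamped biharmonic operator on `[0,1]`. -/
noncomputable def Kgreen (x y : ℝ) : ℝ :=
  if y ≤ x then (1/6) * (1 - x)^2 * y^2 * (2*x*(1 - y) + x - y)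
  else (1/6) * x^2 * (1 - y)^2 * (2*y*(1 - x) + y - x)

/-- The `(N-1)×(N-1)` matrix `K^h` with entries `K^h_{i,j} = h·K(x_i, x_j)`, `h = 1/N`. -/
noncomputable def Kmat (N : ℕ) : Matrix (Fin (N-1)) (Fin (N-1)) ℝ :=
  fun i j => ((1:ℝ)/N) * Kgreen (((i : ℕ) + 1 : ℝ) / N) (((j : ℕ) + 1 : ℝ) / N)

lemma abs_le_mul_of_hasDerivAt {g g' : ℝ → ℝ} {a b C : ℝ}
    (hg : ∀ t ∈ Icc a b, HasDerivAt g (g' t) t) (h0 : g a = 0)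
    (hC : ∀ t ∈ Icc a b, |g' t| ≤ C) : ∀ t ∈ Icc a b, |g t| ≤ C * (b - a) := by
  intro t ht
  have hab : a ≤ b := ht.1.trans ht.2
  have h := Convex.norm_image_sub_le_of_norm_hasDerivWithin_le
    (fun x hx => (hg x hx).hasDerivWithinAt) hC (convex_Icc a b) (left_mem_Icc.2 hab) ht
  rw [h0, sub_zero, Real.norm_eq_abs, Real.norm_eq_abs, abs_of_nonneg (sub_nonneg.2 ht.1)] at h
  have hC0 : 0 ≤ C := (abs_nonneg _).trans (hC t ht)
  exact h.trans (mul_le_mul_of_nonneg_left (by linarith [ht.2]) hC0)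

/-- Error of the trapezoidal rule with end-point correction on a single panel. -/
lemma corrected_trapezoid_panel {F f f1 f2 f3 f4 : ℝ → ℝ} {a b M : ℝ} (hab : a ≤ b)
    (hF : ∀ t ∈ Icc a b, HasDerivAt F (f t) t) (hf : ∀ t, HasDerivAt f (f1 t) t)
    (hf1 : ∀ t, HasDerivAt f1 (f2 t) t) (hf2 : ∀ t, HasDerivAt f2 (f3 t) t)
    (hf3 : ∀ t, HasDerivAt f3 (f4 t) t) (hM : ∀ t ∈ Icc a b, |f4 t| ≤ M) :
    |F b - F a - (b - a) * ((f a + f b) / 2) + (b - a) ^ 2 / 12 * (f1 b - f1 a)|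
      ≤ M * (b - a) ^ 5 := by
  have hM0 : 0 ≤ M := (abs_nonneg _).trans (hM a (left_mem_Icc.2 hab))
  have hs : ∀ t : ℝ, HasDerivAt (fun t => t - a) 1 t := fun t => (hasDerivAt_id t).sub_const a
  have h3 : ∀ t ∈ Icc a b, |(t - a) ^ 2 / 12 * f4 t| ≤ M * (b - a) ^ 2 := by
    intro t ht
    have h1 : (t - a) ^ 2 / 12 ≤ (b - a) ^ 2 := by nlinarith [ht.1, ht.2]
    rw [abs_mul, abs_of_nonneg (by positivity), mul_comm]
    exact mul_le_mul (hM t ht) h1 (by positivity) hM0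
  have h2 := abs_le_mul_of_hasDerivAt
    (g := fun t => (1 / 6) * (f1 t - f1 a) - (t - a) / 6 * f2 t + (t - a) ^ 2 / 12 * f3 t)
    (fun t _ => by
      have := ((((hf1 t).sub_const (f1 a)).const_mul (1 / 6)).sub
        (((hs t).div_const 6).mul (hf2 t))).add ((((hs t).pow 2).div_const 12).mul (hf3 t))
      refine this.congr_deriv ?_
      simp only [Pi.pow_apply]
      ring) (by simp) h3
  have h1 := abs_le_mul_of_hasDerivAt
    (g := fun t => (1 / 2) * (f t - f a) - (t - a) / 3 * f1 t - (t - a) / 6 * f1 a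
      + (t - a) ^ 2 / 12 * f2 t)
    (fun t _ => by
      have := (((((hf t).sub_const (f a)).const_mul (1 / 2)).sub
        (((hs t).div_const 3).mul (hf1 t))).sub (((hs t).div_const 6).mul_const (f1 a))).add
        ((((hs t).pow 2).div_const 12).mul (hf2 t))
      refine this.congr_deriv ?_
      simp only [Pi.pow_apply]
      ring) (by simp) h2
  have h0 := abs_le_mul_of_hasDerivAt
    (g := fun t => F t - F a - (t - a) * ((f a + f t) / 2) + (t - a) ^ 2 / 12 * (f1 t - f1 a))
    (fun t ht => by
      have := (((hF t ht).sub_const (F a)).sub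
        ((hs t).mul (((hf t).const_add (f a)).div_const 2))).add
        ((((hs t).pow 2).div_const 12).mul ((hf1 t).sub_const (f1 a)))
      refine this.congr_deriv ?_
      simp only [Pi.pow_apply]
      ring) (by simp) h1 b (right_mem_Icc.2 hab)
  refine h0.trans (le_of_eq ?_)
  ring

/-- Error of the composite trapezoidal rule with end-point correction on `[m/N, n/N]`. -/
lemma corrected_trapezoid_composite {F f f1 f2 f3 f4 : ℝ → ℝ} {M : ℝ} {N : ℕ} (hN : 0 < N)
    (hF : ∀ t ∈ Icc (0 : ℝ) 1, HasDerivAt F (f t) t) (hf : ∀ t, HasDerivAt f (f1 t) t)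
    (hf1 : ∀ t, HasDerivAt f1 (f2 t) t) (hf2 : ∀ t, HasDerivAt f2 (f3 t) t)
    (hf3 : ∀ t, HasDerivAt f3 (f4 t) t) (hM : ∀ t ∈ Icc (0 : ℝ) 1, |f4 t| ≤ M)
    {m n : ℕ} (hmn : m ≤ n) (hnN : n ≤ N) :
    |F (n / N) - F (m / N)
        - (1 / N : ℝ) * ∑ k ∈ Finset.Ico m n, (f (k / N) + f ((k + 1 : ℕ) / N)) / 2
        + (1 / N : ℝ) ^ 2 / 12 * (f1 (n / N) - f1 (m / N))|
      ≤ (n - m : ℝ) * (M * (1 / N : ℝ) ^ 5) := by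
  induction n, hmn using Nat.le_induction with
  | base => simp
  | succ n hmn ih =>
    have hN' : (0 : ℝ) < N := by exact_mod_cast hN
    have hsub : Icc ((n : ℝ) / N) ((n + 1 : ℕ) / N) ⊆ Icc (0 : ℝ) 1 := by
      apply Icc_subset_Icc
      · positivity
      · rw [div_le_one hN']; exact_mod_cast hnN
    have hp := corrected_trapezoid_panel (a := (n : ℝ) / N) (b := (n + 1 : ℕ) / N) (M := M)
      (by gcongr; simp) (fun t ht => hF t (hsub ht)) hf hf1 hf2 hf3 (fun t ht => hM t (hsub ht))
    have hd : ((n + 1 : ℕ) : ℝ) / N - n / N = 1 / N := by push_cast; ring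
    rw [hd] at hp
    have hi := ih (by omega)
    rw [Finset.sum_Ico_succ_top hmn]
    refine le_trans (le_of_eq ?_) ((abs_add_le _ _).trans (add_le_add hi hp) |>.trans_eq ?_)
    · congr 1; ring
    · push_cast; ring

lemma Matrix.IsHermitian.dotProduct_mulVec_le {n : Type*} [Fintype n] [DecidableEq n]
    {A : Matrix n n ℝ} (hA : A.IsHermitian) (v : n → ℝ) :
    v ⬝ᵥ A.mulVec v ≤ (⨆ i, hA.eigenvalues i) * (v ⬝ᵥ v) := by
  set c := ⨆ i, hA.eigenvalues i with hc
  have hB : (algebraMap ℝ (Matrix n n ℝ) c - A).IsHermitian := by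
    refine Matrix.IsHermitian.sub ?_ hA
    rw [Matrix.algebraMap_eq_diagonal]
    exact Matrix.isHermitian_diagonal _
  have hpos : (algebraMap ℝ (Matrix n n ℝ) c - A).PosSemidef := by
    rw [hB.posSemidef_iff_eigenvalues_nonneg]
    intro i
    have hi := hB.eigenvalues_mem_spectrum_real i
    rw [← spectrum.singleton_sub_eq, hA.spectrum_real_eq_range_eigenvalues] at hi
    obtain ⟨_, rfl, _, ⟨j, rfl⟩, h⟩ := hi
    have hj : hA.eigenvalues j ≤ c := le_ciSup (Set.finite_range _).bddAbove j
    simp only at h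
    rw [Pi.zero_apply, ← h]
    linarith
  have h := hpos.dotProduct_mulVec_nonneg v
  rw [star_trivial, Matrix.sub_mulVec, dotProduct_sub, Algebra.algebraMap_eq_smul_one,
    Matrix.smul_mulVec, Matrix.one_mulVec, dotProduct_smul, smul_eq_mul] at h
  linarith

/-- A solution of the clamped eigenvalue problem together with its derivatives. -/
structure ClampedMode (lam : ℝ) (u u1 u2 u3 u4 : ℝ → ℝ) : Prop where
  h0 : ∀ t, HasDerivAt u (u1 t) t
  h1 : ∀ t, HasDerivAt u1 (u2 t) t
  h2 : ∀ t, HasDerivAt u2 (u3 t) t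
  h3 : ∀ t, HasDerivAt u3 (u4 t) t
  cont : Continuous u4
  eq : ∀ t ∈ Icc (0 : ℝ) 1, u4 t = lam * u t
  left : u 0 = 0
  left' : u1 0 = 0
  right : u 1 = 0
  right' : u1 1 = 0

lemma IsClampedBiharmonicEV.exists_mode {lam : ℝ} (h : IsClampedBiharmonicEV lam) :
    ∃ u u1 u2 u3 u4, ClampedMode lam u u1 u2 u3 u4 ∧ ∃ x ∈ Icc (0 : ℝ) 1, u x ≠ 0 := by
  obtain ⟨φ, hφ, hx, heq, ha, ha', hb, hb'⟩ := h
  have key : ∀ k : ℕ, k < 4 → ∀ t,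
      HasDerivAt (iteratedDeriv k φ) (iteratedDeriv (k + 1) φ t) t := by
    intro k hk t
    rw [iteratedDeriv_succ]
    exact ((hφ.differentiable_iteratedDeriv k (by exact_mod_cast hk)) t).hasDerivAt
  have k0 := key 0 (by norm_num)
  rw [iteratedDeriv_zero] at k0
  refine ⟨φ, iteratedDeriv 1 φ, iteratedDeriv 2 φ, iteratedDeriv 3 φ, iteratedDeriv 4 φ,
    ⟨k0, key 1 (by norm_num), key 2 (by norm_num), key 3 (by norm_num),
      hφ.continuous_iteratedDeriv 4 (by norm_num), heq, ha, ?_, hb, ?_⟩, hx⟩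
  · rwa [iteratedDeriv_one]
  · rwa [iteratedDeriv_one]

namespace ClampedMode

variable {lam : ℝ} {u u1 u2 u3 u4 : ℝ → ℝ}

lemma pos (hu : ClampedMode lam u u1 u2 u3 u4) (hne : ∃ x ∈ Icc (0 : ℝ) 1, u x ≠ 0) :
    0 < lam := by
  by_contra hlam
  have hE : ∀ t, HasDerivAt (fun t => u3 t * u t - u2 t * u1 t) (u4 t * u t - u2 t ^ 2) t := by
    intro t
    refine (((hu.h3 t).mul (hu.h0 t)).sub ((hu.h2 t).mul (hu.h1 t))).congr_deriv ?_
    ring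
  have hnonpos : ∀ t ∈ Icc (0 : ℝ) 1, u4 t * u t - u2 t ^ 2 ≤ 0 := by
    intro t ht
    rw [hu.eq t ht]
    nlinarith [sq_nonneg (u2 t), mul_nonneg (neg_nonneg.2 (not_lt.1 hlam)) (sq_nonneg (u t))]
  have hanti : AntitoneOn (fun t => u3 t * u t - u2 t * u1 t) (Icc 0 1) := by
    refine antitoneOn_of_deriv_nonpos (convex_Icc 0 1)
      (fun t _ => (hE t).continuousAt.continuousWithinAt)
      (fun t _ => (hE t).differentiableAt.differentiableWithinAt) ?_
    intro t ht
    rw [(hE t).deriv]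
    exact hnonpos t (interior_subset ht)
  have hzero : ∀ t ∈ Icc (0 : ℝ) 1, u3 t * u t - u2 t * u1 t = 0 := by
    intro t ht
    have e0 := hanti (left_mem_Icc.2 zero_le_one) ht ht.1
    have e1 := hanti ht (right_mem_Icc.2 zero_le_one) ht.2
    simp only [hu.left, hu.left', hu.right, hu.right', mul_zero, sub_zero] at e0 e1
    exact le_antisymm e0 e1
  have hu2 : ∀ t ∈ Ioo (0 : ℝ) 1, u2 t = 0 := by
    intro t ht
    have hev : (fun t => u3 t * u t - u2 t * u1 t) =ᶠ[nhds t] fun _ => 0 := by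
      filter_upwards [Ioo_mem_nhds ht.1 ht.2] with s hs
      exact hzero s ⟨hs.1.le, hs.2.le⟩
    have hd := (hE t).unique ((hasDerivAt_const t (0 : ℝ)).congr_of_eventuallyEq hev)
    rw [hu.eq t ⟨ht.1.le, ht.2.le⟩] at hd
    have := mul_nonneg (neg_nonneg.2 (not_lt.1 hlam)) (sq_nonneg (u t))
    exact pow_eq_zero_iff two_ne_zero |>.1 (by nlinarith [sq_nonneg (u2 t)])
  have hconst : ∀ f g : ℝ → ℝ, (∀ t, HasDerivAt f (g t) t) → f 0 = 0 →
      (∀ t ∈ Ioo (0 : ℝ) 1, g t = 0) → ∀ t ∈ Icc (0 : ℝ) 1, f t = 0 := by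
    intro f g hf hf0 hg t ht
    rcases ht.1.eq_or_lt with rfl | h0t
    · exact hf0
    obtain ⟨c, hc, hc'⟩ := exists_hasDerivAt_eq_slope f g h0t
      (fun s _ => (hf s).continuousAt.continuousWithinAt) (fun s _ => hf s)
    rw [hg c ⟨hc.1, hc.2.trans_le ht.2⟩, hf0, sub_zero, sub_zero, eq_comm,
      div_eq_zero_iff] at hc'
    exact hc'.resolve_right h0t.ne'
  have hu1 := hconst u1 u2 hu.h1 hu.left' hu2
  have hu0 := hconst u u1 hu.h0 hu.left fun t ht => hu1 t ⟨ht.1.le, ht.2.le⟩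
  obtain ⟨x, hx, hx'⟩ := hne
  exact hx' (hu0 x hx)

lemma exists_bound (hu : ClampedMode lam u u1 u2 u3 u4) :
    ∃ B > 0, ∀ t ∈ Icc (0 : ℝ) 1,
      |u t| ≤ B ∧ |u1 t| ≤ B ∧ |u2 t| ≤ B ∧ |u3 t| ≤ B ∧ |u4 t| ≤ B := by
  have hc : ∀ f g : ℝ → ℝ, (∀ t, HasDerivAt f (g t) t) → Continuous f := fun f g h =>
    continuous_iff_continuousAt.2 fun t => (h t).continuousAt
  have hb : ∀ f : ℝ → ℝ, Continuous f → ∃ B, ∀ t ∈ Icc (0 : ℝ) 1, |f t| ≤ B := fun f hf =>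
    isCompact_Icc.exists_bound_of_continuousOn hf.continuousOn
  obtain ⟨b0, h0⟩ := hb u (hc _ _ hu.h0)
  obtain ⟨b1, h1⟩ := hb u1 (hc _ _ hu.h1)
  obtain ⟨b2, h2⟩ := hb u2 (hc _ _ hu.h2)
  obtain ⟨b3, h3⟩ := hb u3 (hc _ _ hu.h3)
  obtain ⟨b4, h4⟩ := hb u4 hu.cont
  refine ⟨|b0| + |b1| + |b2| + |b3| + |b4| + 1, by positivity, fun t ht => ?_⟩
  have a0 := h0 t ht
  have a1 := h1 t ht
  have a2 := h2 t ht
  have a3 := h3 t ht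
  have a4 := h4 t ht
  have c0 := le_abs_self b0
  have c1 := le_abs_self b1
  have c2 := le_abs_self b2
  have c3 := le_abs_self b3
  have c4 := le_abs_self b4
  have d0 := abs_nonneg b0
  have d1 := abs_nonneg b1
  have d2 := abs_nonneg b2
  have d3 := abs_nonneg b3
  have d4 := abs_nonneg b4
  refine ⟨?_, ?_, ?_, ?_, ?_⟩ <;> linarith

/-- Corrected trapezoidal rule for the product of a cubic polynomial with a mode; the integral
is given in closed form by integration by parts. -/
lemma cubic_quadrature (hu : ClampedMode lam u u1 u2 u3 u4) (hlam : lam ≠ 0) {B : ℝ}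
    (hB : ∀ t ∈ Icc (0 : ℝ) 1,
      |u t| ≤ B ∧ |u1 t| ≤ B ∧ |u2 t| ≤ B ∧ |u3 t| ≤ B ∧ |u4 t| ≤ B)
    {c0 c1 c2 c3 : ℝ} (hc0 : |c0| ≤ 1) (hc1 : |c1| ≤ 1) (hc2 : |c2| ≤ 1) (hc3 : |c3| ≤ 1)
    {p p1 p2 F f f1 : ℝ → ℝ}
    (hp : p = fun t => c0 + c1 * t + c2 * t ^ 2 + c3 * t ^ 3)
    (hp1 : p1 = fun t => c1 + 2 * c2 * t + 3 * c3 * t ^ 2)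
    (hp2 : p2 = fun t => 2 * c2 + 6 * c3 * t)
    (hF : F = fun t => (p t * u3 t - p1 t * u2 t + p2 t * u1 t - 6 * c3 * u t) / lam)
    (hf : f = fun t => p t * u t) (hf1 : f1 = fun t => p1 t * u t + p t * u1 t)
    {N : ℕ} (hN : 0 < N) {m n : ℕ} (hmn : m ≤ n) (hnN : n ≤ N) :
    |F (n / N) - F (m / N)
        - (1 / N : ℝ) * ∑ k ∈ Finset.Ico m n, (f (k / N) + f ((k + 1 : ℕ) / N)) / 2
        + (1 / N : ℝ) ^ 2 / 12 * (f1 (n / N) - f1 (m / N))|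
      ≤ (n - m : ℝ) * (100 * B * (1 / N : ℝ) ^ 5) := by
  have dp : ∀ t, HasDerivAt p (p1 t) t := by
    intro t
    rw [hp, hp1]
    have := ((((hasDerivAt_id t).const_mul c1).const_add c0).add
      (((hasDerivAt_id t).pow 2).const_mul c2)).add (((hasDerivAt_id t).pow 3).const_mul c3)
    refine this.congr_deriv ?_
    simp
    ring
  have dp1 : ∀ t, HasDerivAt p1 (p2 t) t := by
    intro t
    rw [hp1, hp2]
    have := (((hasDerivAt_id t).const_mul (2 * c2)).const_add c1).add
      (((hasDerivAt_id t).pow 2).const_mul (3 * c3))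
    refine this.congr_deriv ?_
    simp
    ring
  have dp2 : ∀ t, HasDerivAt p2 (6 * c3) t := by
    intro t
    rw [hp2]
    refine (((hasDerivAt_id t).const_mul (6 * c3)).const_add (2 * c2)).congr_deriv ?_
    simp
  refine corrected_trapezoid_composite (f2 := fun t => p2 t * u t + 2 * p1 t * u1 t + p t * u2 t)
    (f3 := fun t => 6 * c3 * u t + 3 * p2 t * u1 t + 3 * p1 t * u2 t + p t * u3 t)
    (f4 := fun t => 4 * (6 * c3) * u1 t + 6 * p2 t * u2 t + 4 * p1 t * u3 t + p t * u4 t)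
    hN ?_ ?_ ?_ ?_ ?_ ?_ hmn hnN
  · intro t ht
    rw [hF, hf]
    have := (((((dp t).mul (hu.h3 t)).sub ((dp1 t).mul (hu.h2 t))).add
      ((dp2 t).mul (hu.h1 t))).sub ((hu.h0 t).const_mul (6 * c3))).div_const lam
    refine this.congr_deriv ?_
    rw [hu.eq t ht]
    field_simp
    ring
  · intro t
    rw [hf, hf1]
    exact (dp t).mul (hu.h0 t)
  · intro t
    rw [hf1]
    refine (((dp1 t).mul (hu.h0 t)).add ((dp t).mul (hu.h1 t))).congr_deriv ?_
    ring
  · intro t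
    refine ((((dp2 t).mul (hu.h0 t)).add (((dp1 t).const_mul 2).mul (hu.h1 t))).add
      ((dp t).mul (hu.h2 t))).congr_deriv ?_
    ring
  · intro t
    refine (((((hu.h0 t).const_mul (6 * c3)).add (((dp2 t).const_mul 3).mul (hu.h1 t))).add
      (((dp1 t).const_mul 3).mul (hu.h2 t))).add ((dp t).mul (hu.h3 t))).congr_deriv ?_
    ring
  · intro t ht
    obtain ⟨-, b1, b2, b3, b4⟩ := hB t ht
    have hmul : ∀ c s : ℝ, |c| ≤ 1 → s ∈ Icc (0 : ℝ) 1 → |c * s| ≤ 1 := by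
      intro c s hc hs
      rw [abs_mul, abs_of_nonneg hs.1]
      exact mul_le_one₀ hc hs.1 hs.2
    have ht2 : t ^ 2 ∈ Icc (0 : ℝ) 1 := ⟨by positivity, pow_le_one₀ ht.1 ht.2⟩
    have ht3 : t ^ 3 ∈ Icc (0 : ℝ) 1 := ⟨pow_nonneg ht.1 3, pow_le_one₀ ht.1 ht.2⟩
    have e0 := abs_le.1 hc0
    have e1 := abs_le.1 hc1
    have e2 := abs_le.1 hc2
    have e3 := abs_le.1 hc3
    have e11 := abs_le.1 (hmul c1 t hc1 ht)
    have e21 := abs_le.1 (hmul c2 t hc2 ht)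
    have e31 := abs_le.1 (hmul c3 t hc3 ht)
    have e22 := abs_le.1 (hmul c2 _ hc2 ht2)
    have e32 := abs_le.1 (hmul c3 _ hc3 ht2)
    have e33 := abs_le.1 (hmul c3 _ hc3 ht3)
    have q0 : |p t| ≤ 4 := by rw [hp, abs_le]; constructor <;> simp only <;> linarith
    have q1 : |p1 t| ≤ 6 := by rw [hp1, abs_le]; constructor <;> simp only <;> linarith
    have q2 : |p2 t| ≤ 8 := by rw [hp2, abs_le]; constructor <;> simp only <;> linarith
    have r1 : |4 * (6 * c3) * u1 t| ≤ 24 * B := by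
      rw [abs_mul]
      exact mul_le_mul (by rw [abs_le]; constructor <;> linarith) b1 (abs_nonneg _) (by norm_num)
    have r2 : |6 * p2 t * u2 t| ≤ 48 * B := by
      rw [abs_mul, abs_mul, abs_of_pos (by norm_num : (0 : ℝ) < 6)]
      exact mul_le_mul (by linarith) b2 (abs_nonneg _) (by norm_num)
    have r3 : |4 * p1 t * u3 t| ≤ 24 * B := by
      rw [abs_mul, abs_mul, abs_of_pos (by norm_num : (0 : ℝ) < 4)]
      exact mul_le_mul (by linarith) b3 (abs_nonneg _) (by norm_num)
    have r4 : |p t * u4 t| ≤ 4 * B := by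
      rw [abs_mul]
      exact mul_le_mul q0 b4 (abs_nonneg _) (by norm_num)
    have s1 := abs_le.1 r1
    have s2 := abs_le.1 r2
    have s3 := abs_le.1 r3
    have s4 := abs_le.1 r4
    rw [abs_le]
    constructor <;> linarith

/-- Nyström consistency of order four at the grid points. -/
lemma nystrom_consistency (hu : ClampedMode lam u u1 u2 u3 u4) (hlam : lam ≠ 0) {B : ℝ}
    (hB : ∀ t ∈ Icc (0 : ℝ) 1,
      |u t| ≤ B ∧ |u1 t| ≤ B ∧ |u2 t| ≤ B ∧ |u3 t| ≤ B ∧ |u4 t| ≤ B)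
    {N : ℕ} (hN : 0 < N) {i : ℕ} (hi : i ≤ N) :
    |(1 / N : ℝ) * ∑ k ∈ Finset.range (N - 1),
        Kgreen (i / N) ((k + 1 : ℝ) / N) * u ((k + 1 : ℝ) / N) - u (i / N) / lam|
      ≤ 100 * B * (1 / N : ℝ) ^ 4 := by
  have hN' : (0 : ℝ) < N := by exact_mod_cast hN
  have hx0 : (0 : ℝ) ≤ i / N := by positivity
  have hx1 : (i : ℝ) / N ≤ 1 := by rw [div_le_one hN']; exact_mod_cast hi
  set x : ℝ := i / N with hx
  have hy0 : 0 ≤ 1 - x := by linarith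
  have m0 := mul_nonneg hx0 hy0
  have m1 := mul_nonneg hx0 m0
  have m2 := mul_nonneg hy0 m0
  have hL := hu.cubic_quadrature hlam hB (c0 := 0) (c1 := 0) (c2 := (1 - x) ^ 2 * x / 2)
    (c3 := -((1 - x) ^ 2 * (2 * x + 1) / 6)) (by simp) (by simp)
    (by rw [abs_le]; constructor <;> nlinarith [m0, m1, m2])
    (by rw [abs_le]; constructor <;> nlinarith [m0, m1, m2])
    rfl rfl rfl rfl rfl rfl hN (Nat.zero_le i) hi
  have hR := hu.cubic_quadrature hlam hB (c0 := -(x ^ 3 / 6)) (c1 := x ^ 2 / 2)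
    (c2 := (1 - x) ^ 2 * x / 2 - x / 2)
    (c3 := -((1 - x) ^ 2 * (2 * x + 1) / 6) + 1 / 6)
    (by rw [abs_le]; constructor <;> nlinarith [pow_nonneg hx0 3, pow_le_one₀ (n := 3) hx0 hx1])
    (by rw [abs_le]; constructor <;> nlinarith)
    (by rw [abs_le]; constructor <;> nlinarith [m0, m1, m2])
    (by rw [abs_le]; constructor <;> nlinarith [m0, m1, m2])
    rfl rfl rfl rfl rfl rfl hN hi le_rfl
  set g : ℕ → ℝ := fun k => Kgreen x (k / N) * u (k / N) with hg
  have hle : ∀ k, k ≤ i → g k = (0 + 0 * ((k : ℝ) / N) + (1 - x) ^ 2 * x / 2 * ((k : ℝ) / N) ^ 2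
      + -((1 - x) ^ 2 * (2 * x + 1) / 6) * ((k : ℝ) / N) ^ 3) * u (k / N) := by
    intro k hk
    have : (k : ℝ) / N ≤ x := by rw [hx]; gcongr
    simp only [hg, Kgreen, if_pos this]
    ring
  have hge : ∀ k, i ≤ k → g k = (-(x ^ 3 / 6) + x ^ 2 / 2 * ((k : ℝ) / N)
      + ((1 - x) ^ 2 * x / 2 - x / 2) * ((k : ℝ) / N) ^ 2
      + (-((1 - x) ^ 2 * (2 * x + 1) / 6) + 1 / 6) * ((k : ℝ) / N) ^ 3) * u (k / N) := by
    intro k hk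
    rcases hk.eq_or_lt with rfl | hk
    · simp only [hg, Kgreen, ← hx, le_refl, if_true]
      ring
    · have : ¬ (k : ℝ) / N ≤ x := by
        rw [hx, not_le]
        gcongr
      simp only [hg, Kgreen, if_neg this]
      ring
  have hsL : ∀ k ∈ Finset.Ico 0 i, (g k + g (k + 1)) / 2 = _ := fun k hk => by
    rw [hle k (by simp at hk; omega), hle (k + 1) (by simp at hk; omega)]
  have hsR : ∀ k ∈ Finset.Ico i N, (g k + g (k + 1)) / 2 = _ := fun k hk => by
    rw [hge k (by simp at hk; omega), hge (k + 1) (by simp at hk; omega)]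
  rw [← Finset.sum_congr rfl hsL] at hL
  rw [← Finset.sum_congr rfl hsR] at hR
  have hg0 : g 0 = 0 := by simp [hg, hu.left]
  have hgN : g N = 0 := by simp [hg, div_self hN'.ne', hu.right]
  have hsum : ∑ k ∈ Finset.Ico 0 i, (g k + g (k + 1)) / 2
      + ∑ k ∈ Finset.Ico i N, (g k + g (k + 1)) / 2
      = ∑ k ∈ Finset.range (N - 1), g (k + 1) := by
    rw [Finset.sum_Ico_consecutive _ (Nat.zero_le i) hi, Nat.Ico_zero_eq_range]
    have e1 : ∑ k ∈ Finset.range N, g (k + 1) = ∑ k ∈ Finset.range N, g k := by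
      have a := Finset.sum_range_succ g N
      have b := Finset.sum_range_succ' g N
      rw [hg0] at b
      rw [hgN] at a
      linarith
    have e2 : ∑ k ∈ Finset.range N, g (k + 1) = ∑ k ∈ Finset.range (N - 1), g (k + 1) := by
      obtain ⟨n, rfl⟩ := Nat.exists_eq_succ_of_ne_zero hN.ne'
      rw [Finset.sum_range_succ]
      simpa using hgN
    rw [← Finset.sum_div, Finset.sum_add_distrib, ← e1, e2]
    ring
  have hgk : ∑ k ∈ Finset.range (N - 1), Kgreen x ((k + 1 : ℝ) / N) * u ((k + 1 : ℝ) / N)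
      = ∑ k ∈ Finset.range (N - 1), g (k + 1) := by
    simp [hg]
  rw [hgk, ← hsum, abs_sub_comm]
  refine le_trans (le_of_eq ?_) ((abs_add_le _ _).trans (add_le_add hL hR) |>.trans_eq ?_)
  · congr 1
    simp only [← hx, Nat.cast_zero, zero_div, div_self hN'.ne', hu.left, hu.left', hu.right,
      hu.right']
    field_simp
    ring
  · push_cast
    field_simp
    ring

end ClampedMode

lemma abs_Kgreen_le_one {x y : ℝ} (hx : x ∈ Icc (0 : ℝ) 1) (hy : y ∈ Icc (0 : ℝ) 1) :
    |Kgreen x y| ≤ 1 := by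
  have key : ∀ a b : ℝ, a ∈ Icc (0 : ℝ) 1 → b ∈ Icc (0 : ℝ) 1 → b ≤ a →
      |(1 / 6) * (1 - a) ^ 2 * b ^ 2 * (2 * a * (1 - b) + a - b)| ≤ 1 := by
    intro a b ⟨ha0, ha1⟩ ⟨hb0, hb1⟩ hab
    have h1 : (1 - a) ^ 2 ≤ 1 := pow_le_one₀ (by linarith) (by linarith)
    have h2 : b ^ 2 ≤ 1 := pow_le_one₀ hb0 hb1
    have h3 : a * (1 - b) ≤ 1 := mul_le_one₀ ha1 (by linarith) (by linarith)
    have h3' : 0 ≤ a * (1 - b) := mul_nonneg ha0 (by linarith)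
    have h4 : (1 - a) ^ 2 * b ^ 2 ≤ 1 := mul_le_one₀ h1 (by positivity) h2
    have h5 : 0 ≤ 2 * a * (1 - b) + a - b := by linarith
    rw [abs_of_nonneg (by positivity)]
    have h6 := mul_le_mul h4 (by linarith : 2 * a * (1 - b) + a - b ≤ 3) h5 zero_le_one
    linarith
  unfold Kgreen
  split_ifs with h
  · exact key x y hx hy h
  · rw [mul_right_comm (1 / 6 : ℝ)]
    exact key y x hy hx (not_le.1 h).le

/-- The discrete `ℓ¹` norm of a mode on the grid is bounded below for fine grids. -/
lemma ClampedMode.exists_discrete_norm_lower_bound {lam : ℝ} {u u1 u2 u3 u4 : ℝ → ℝ}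
    (hu : ClampedMode lam u u1 u2 u3 u4) (hne : ∃ x ∈ Icc (0 : ℝ) 1, u x ≠ 0) :
    ∃ c > 0, ∃ N₀ : ℕ, ∀ N ≥ N₀, 0 < N →
      c ≤ (1 / N : ℝ) * ∑ k ∈ Finset.range (N - 1), |u ((k + 1 : ℝ) / N)| := by
  have hlam := hu.pos hne
  obtain ⟨x, hx, hux⟩ := hne
  obtain ⟨B, hB0, hB⟩ := hu.exists_bound
  have hux' : 0 < |u x| := abs_pos.2 hux
  have hc : ContinuousAt u x := (hu.h0 x).continuousAt
  obtain ⟨δ, hδ, hd⟩ := Metric.continuousAt_iff.1 hc (|u x| / 2) (by positivity)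
  set c := |u x| / (4 * lam) with hcdef
  have hcpos : 0 < c := by positivity
  obtain ⟨N₁, hN₁⟩ := exists_nat_gt (1 / δ)
  obtain ⟨N₂, hN₂⟩ := exists_nat_gt (100 * B / c)
  refine ⟨c, hcpos, max N₁ N₂, fun N hNN hN => ?_⟩
  have hN' : (0 : ℝ) < N := by exact_mod_cast hN
  have hN1' : (1 : ℝ) ≤ N := by exact_mod_cast hN
  have g1 : 1 / δ < N := hN₁.trans_le (by exact_mod_cast (le_max_left _ _).trans hNN)
  have g2 : 100 * B / c < N := hN₂.trans_le (by exact_mod_cast (le_max_right _ _).trans hNN)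
  set i := ⌊x * N⌋₊ with hidef
  have hxN : 0 ≤ x * N := mul_nonneg hx.1 hN'.le
  have f1 : (i : ℝ) ≤ x * N := Nat.floor_le hxN
  have f2 : x * N < i + 1 := Nat.lt_floor_add_one _
  have hi : i ≤ N := by
    have : (i : ℝ) ≤ N := f1.trans (by nlinarith [hx.2])
    exact_mod_cast this
  have hdist : dist ((i : ℝ) / N) x < δ := by
    rw [Real.dist_eq, abs_lt]
    have a1 : (i : ℝ) / N ≤ x := by rw [div_le_iff₀ hN']; exact f1
    have a2 : x - 1 / N < (i : ℝ) / N := by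
      rw [lt_div_iff₀ hN', sub_mul, one_div_mul_cancel hN'.ne']; linarith
    have a3 : (1 : ℝ) / N < δ := by
      rw [div_lt_iff₀ hN']
      rw [div_lt_iff₀ hδ] at g1
      linarith
    constructor <;> linarith
  have hui : |u x| / 2 ≤ |u (i / N)| := by
    have h := hd hdist
    rw [Real.dist_eq] at h
    have := abs_sub_abs_le_abs_sub (u x) (u (i / N))
    rw [abs_sub_comm] at this
    linarith
  have hcons := hu.nystrom_consistency hlam.ne' hB hN hi
  set S := ∑ k ∈ Finset.range (N - 1),
        Kgreen (i / N) ((k + 1 : ℝ) / N) * u ((k + 1 : ℝ) / N) with hS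
  have hSle : |S| ≤ ∑ k ∈ Finset.range (N - 1), |u ((k + 1 : ℝ) / N)| := by
    refine (Finset.abs_sum_le_sum_abs _ _).trans (Finset.sum_le_sum fun k hk => ?_)
    rw [abs_mul]
    refine mul_le_of_le_one_left (abs_nonneg _) (abs_Kgreen_le_one ⟨by positivity, ?_⟩
      ⟨by positivity, ?_⟩)
    · rw [div_le_one hN']; exact_mod_cast hi
    · rw [div_le_one hN']
      have : k + 1 ≤ N := by have := Finset.mem_range.1 hk; omega
      exact_mod_cast this
  have herr : 100 * B * (1 / N : ℝ) ^ 4 ≤ c := by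
    have h4 : (1 / N : ℝ) ^ 4 ≤ 1 / N := by
      refine pow_le_of_le_one (by positivity) ?_ (by norm_num)
      rw [div_le_one hN']; exact hN1'
    rw [div_lt_iff₀ hcpos] at g2
    calc 100 * B * (1 / N : ℝ) ^ 4 ≤ 100 * B * (1 / N) := by gcongr
      _ ≤ c := by rw [mul_one_div, div_le_iff₀ hN']; linarith
  have hmain : 2 * c ≤ |u (i / N) / lam| := by
    rw [abs_div, abs_of_pos hlam, hcdef]
    calc 2 * (|u x| / (4 * lam)) = |u x| / 2 / lam := by field_simp; norm_num
      _ ≤ _ := by gcongr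
  have htri := abs_sub_abs_le_abs_sub (u (i / N) / lam) (1 / N * S)
  rw [abs_sub_comm] at htri
  have hS' : |1 / N * S| = 1 / N * |S| := by rw [abs_mul, abs_of_pos (by positivity)]
  have : 1 / N * |S| ≤ (1 / N : ℝ) * ∑ k ∈ Finset.range (N - 1), |u ((k + 1 : ℝ) / N)| := by
    gcongr
  linarith

/-- The largest eigenvalue of `Kmat N` exceeds `1 / lam` up to an error of order four. -/
lemma ClampedMode.exists_iSup_eigenvalues_ge {lam : ℝ} {u u1 u2 u3 u4 : ℝ → ℝ}
    (hu : ClampedMode lam u u1 u2 u3 u4) (hne : ∃ x ∈ Icc (0 : ℝ) 1, u x ≠ 0) :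
    ∃ D > 0, ∃ N₀ : ℕ, ∀ N ≥ N₀, 0 < N → ∀ hsym : (Kmat N).IsHermitian,
      1 / lam - D * (1 / N : ℝ) ^ 4 ≤ ⨆ i, hsym.eigenvalues i := by
  have hlam := hu.pos hne
  obtain ⟨B, hB0, hB⟩ := hu.exists_bound
  obtain ⟨c, hc, N₀, hN₀⟩ := hu.exists_discrete_norm_lower_bound hne
  refine ⟨100 * B / c, by positivity, N₀, fun N hNN hN hsym => ?_⟩
  have hN' : (0 : ℝ) < N := by exact_mod_cast hN
  have hS1 := hN₀ N hNN hN
  set v : Fin (N - 1) → ℝ := fun j => u (((j : ℕ) + 1 : ℝ) / N) with hv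
  rw [← Fin.sum_univ_eq_sum_range (fun k : ℕ => |u ((k + 1 : ℝ) / N)|)] at hS1
  change c ≤ 1 / N * ∑ j, |v j| at hS1
  set ε := 100 * B * (1 / N : ℝ) ^ 4 with hε
  have hε0 : 0 ≤ ε := by positivity
  have hcons : ∀ i, |(Kmat N).mulVec v i - v i / lam| ≤ ε := by
    intro i
    have h := hu.nystrom_consistency hlam.ne' hB hN (i := (i : ℕ) + 1) (by omega)
    rw [← Fin.sum_univ_eq_sum_range (fun k : ℕ =>
      Kgreen (((i : ℕ) + 1 : ℕ) / N) ((k + 1 : ℝ) / N) * u ((k + 1 : ℝ) / N))] at h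
    convert h using 3
    · simp only [Matrix.mulVec, dotProduct, Kmat, Finset.mul_sum, hv]
      push_cast
      exact Finset.sum_congr rfl fun j _ => mul_assoc _ _ _
    · simp [hv]
  have hray := hsym.dotProduct_mulVec_le v
  set μ := ⨆ i, hsym.eigenvalues i
  have hlow : (v ⬝ᵥ v) / lam - ε * ∑ j, |v j| ≤ v ⬝ᵥ (Kmat N).mulVec v := by
    simp only [dotProduct, Finset.sum_div, Finset.mul_sum]
    rw [← Finset.sum_sub_distrib]
    refine Finset.sum_le_sum fun j _ => ?_
    have h1 : |v j * ((Kmat N).mulVec v j - v j / lam)| ≤ ε * |v j| := by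
      rw [abs_mul, mul_comm]
      exact mul_le_mul_of_nonneg_right (hcons j) (abs_nonneg _)
    have h2 := (abs_le.1 h1).1
    have h3 : v j * v j / lam = v j * (v j / lam) := mul_div_assoc _ _ _
    rw [mul_sub, ← h3] at h2
    linarith
  set S := ∑ j, |v j| with hS
  have hS0 : 0 < S := by
    by_contra hneg
    have : 1 / (N : ℝ) * S ≤ 0 := mul_nonpos_of_nonneg_of_nonpos (by positivity) (not_lt.1 hneg)
    linarith
  have hcs : S ^ 2 ≤ N * (v ⬝ᵥ v) := by
    have h := sq_sum_le_card_mul_sum_sq (s := Finset.univ) (f := fun j => |v j|)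
    have hvv : ∑ j, |v j| ^ 2 = v ⬝ᵥ v := by
      simp only [dotProduct, sq_abs]
      exact Finset.sum_congr rfl fun j _ => sq _
    rw [hvv, Finset.card_univ, Fintype.card_fin] at h
    refine h.trans ?_
    have : ((N - 1 : ℕ) : ℝ) ≤ N := by exact_mod_cast Nat.sub_le N 1
    refine mul_le_mul_of_nonneg_right this ?_
    rw [← hvv]
    positivity
  have hcS : c * S ≤ v ⬝ᵥ v := by
    have : c * N ≤ S := by
      rwa [one_div_mul_eq_div, le_div_iff₀ hN'] at hS1
    have h2 : c * N * S ≤ N * (v ⬝ᵥ v) := by nlinarith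
    nlinarith
  have hV : 0 < v ⬝ᵥ v := lt_of_lt_of_le (by positivity) hcS
  have hD : 100 * B / c * (1 / N : ℝ) ^ 4 = ε / c := by rw [hε]; ring
  rw [hD]
  have h5 : ε * S ≤ ε / c * (v ⬝ᵥ v) := by
    calc ε * S = ε / c * (c * S) := by field_simp
      _ ≤ _ := by gcongr
  refine le_of_mul_le_mul_right ?_ hV
  calc (1 / lam - ε / c) * (v ⬝ᵥ v) = (v ⬝ᵥ v) / lam - ε / c * (v ⬝ᵥ v) := by ring
    _ ≤ _ := by linarith

lemma inv_le_add_of_sub_le {lam μ D e : ℝ} (hlam : 0 < lam) (he : 2 * lam * (D * e) ≤ 1)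
    (hμ : 1 / lam - D * e ≤ μ) (hDe : 0 ≤ D * e) : μ⁻¹ ≤ lam + 2 * lam ^ 2 * D * e := by
  have h1 : 1 - lam * (D * e) ≤ lam * μ := by
    have := mul_le_mul_of_nonneg_left hμ hlam.le
    rwa [mul_sub, mul_one_div_cancel hlam.ne'] at this
  have hμ0 : 0 < μ := by
    by_contra hneg
    nlinarith [mul_nonneg hlam.le (neg_nonneg.2 (not_lt.1 hneg))]
  rw [inv_le_iff_one_le_mul₀ hμ0]
  have hz : 0 ≤ lam * (D * e) := by positivity
  have h2 := mul_le_mul_of_nonneg_left h1 (by linarith : 0 ≤ 1 + 2 * (lam * (D * e)))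
  nlinarith

/-- One-sided fourth-order bound for the first discrete eigenvalue: there is `C > 0` such
that for all `N ≥ 2` the largest eigenvalue `μ_{h,1}` of `K^h` satisfies
`1/μ_{h,1} ≤ λ₁ + C·h⁴`. -/
theorem first_discrete_eigenvalue_upper_bound
    (lam1 : ℝ) (h1 : IsClampedBiharmonicEV lam1)
    (hmin : ∀ μ : ℝ, IsClampedBiharmonicEV μ → lam1 ≤ μ) :
    ∃ C > (0:ℝ), ∀ N : ℕ, 2 ≤ N → ∀ hsym : (Kmat N).IsHermitian,
      (⨆ i, hsym.eigenvalues i)⁻¹ ≤ lam1 + C * ((1:ℝ)/N)^4 := by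
  obtain ⟨u, u1, u2, u3, u4, hu, hne⟩ := h1.exists_mode
  have hlam := hu.pos hne
  obtain ⟨D, hD, N₀, hN₀⟩ := hu.exists_iSup_eigenvalues_ge hne
  obtain ⟨N₁, hN₁⟩ := exists_nat_gt (2 * lam1 * D)
  have hfin : ∀ N : ℕ, ∃ b : ℝ, ∀ hsym : (Kmat N).IsHermitian,
      (⨆ i, hsym.eigenvalues i)⁻¹ ≤ b := by
    intro N
    by_cases h : (Kmat N).IsHermitian
    · exact ⟨(⨆ i, h.eigenvalues i)⁻¹, fun _ => le_rfl⟩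
    · exact ⟨0, fun h' => absurd h' h⟩
  choose b hb using hfin
  set M := max N₀ N₁
  have hC0 : 0 ≤ ∑ N ∈ Finset.range M, |b N| * (N : ℝ) ^ 4 :=
    Finset.sum_nonneg fun _ _ => by positivity
  refine ⟨2 * lam1 ^ 2 * D + ∑ N ∈ Finset.range M, |b N| * (N : ℝ) ^ 4, by positivity,
    fun N hN hsym => ?_⟩
  have hN' : (0 : ℝ) < N := by exact_mod_cast (by omega : 0 < N)
  have hN1 : (1 : ℝ) ≤ N := by exact_mod_cast (by omega : 1 ≤ N)
  rcases lt_or_ge N M with hlt | hge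
  · have hle : |b N| * (N : ℝ) ^ 4 ≤ ∑ N ∈ Finset.range M, |b N| * (N : ℝ) ^ 4 :=
      Finset.single_le_sum (f := fun N : ℕ => |b N| * (N : ℝ) ^ 4)
        (fun _ _ => by positivity) (Finset.mem_range.2 hlt)
    have h2 : |b N| ≤ (∑ N ∈ Finset.range M, |b N| * (N : ℝ) ^ 4) * (1 / N : ℝ) ^ 4 := by
      rw [one_div, inv_pow, ← div_eq_mul_inv, le_div_iff₀ (by positivity)]
      exact hle
    have h3 : 0 ≤ 2 * lam1 ^ 2 * D * (1 / N : ℝ) ^ 4 := by positivity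
    have h4 := hb N hsym
    have h5 := le_abs_self (b N)
    rw [add_mul]
    linarith
  · have hpow : (1 / N : ℝ) ^ 4 ≤ 1 / N := by
      refine pow_le_of_le_one (by positivity) ?_ (by norm_num)
      rw [div_le_one hN']
      exact hN1
    have hsmall : 2 * lam1 * (D * (1 / N : ℝ) ^ 4) ≤ 1 := by
      have h6 : 2 * lam1 * D < N :=
        hN₁.trans_le (by exact_mod_cast (le_max_right _ _).trans hge)
      calc 2 * lam1 * (D * (1 / N : ℝ) ^ 4) ≤ 2 * lam1 * (D * (1 / N)) := by gcongr
        _ = 2 * lam1 * D / N := by ring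
        _ ≤ 1 := by rw [div_le_one hN']; exact h6.le
    have h := inv_le_add_of_sub_le hlam hsmall
      (hN₀ N ((le_max_left _ _).trans hge) (by omega) hsym) (by positivity)
    have h7 : 0 ≤ (∑ N ∈ Finset.range M, |b N| * (N : ℝ) ^ 4) * (1 / N : ℝ) ^ 4 := by
      positivity
    rw [add_mul]
    linarith
end

section
/- Collective quadratic estimate for all eigenvalue differences: let 0 < λ₁ < λ₂ < ⋯ be the eigenvalues of the clamped biharmonic operator on [0,1], let μ_{h,1} ≥ μ_{h,2} ≥ ⋯ ≥ μ_{h,N−1} > 0 be the eigenvalues of the matrix K^h in decreasing order (counted with multiplicity), and let K_h be the piecewise-constant kernel defined by K_h(x,y) = K(x_i, x_j) whenever x ∈ (x_i − h/2, x_i + h/2) ∩ [0,1] and y ∈ (x_j − h/2, x_j + h/2) ∩ [0,1], 0 ≤ i, j ≤ N. Then Σ_{k=1}^{N−1} |λ_k⁻¹ − μ_{h,k}|² + Σ_{k=N}^{∞} λ_k⁻² ≤ ∫_0^1 ∫_0^1 |K(x,y) − K_h(x,y)|² dx dy, and there exists a constant C > 0 independent of h such that ∫_0^1 ∫_0^1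 |K(x,y) − K_h(x,y)|² dx dy ≤ C·h². -/
open Set MeasureTheory

/-- The piecewise-constant kernel `K_h`: `K_h(x,y) = K(x_i, x_j)` for
`x ∈ (x_i - h/2, x_i + h/2)`, `y ∈ (x_j - h/2, x_j + h/2)` (the nearest grid points,
realized through rounding). -/
noncomputable def Kpc (N : ℕ) (x y : ℝ) : ℝ :=
  Kgreen (((round ((N : ℝ) * x) : ℤ) : ℝ) / N) (((round ((N : ℝ) * y) : ℤ) : ℝ) / N)

section SpectralInequalities

variable {H : Type*} [NormedAddCommGroup H] [InnerProductSpace ℝ H] [CompleteSpace H]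

/-- If `T` vanishes on the orthogonal complement of an orthonormal family of eigenvectors, its
quadratic form is diagonal in that family. -/
lemma hasSum_quadraticForm {T : H →L[ℝ] H} {e : ℕ → H} {κ : ℕ → ℝ}
    (he : Orthonormal ℝ e) (hTe : ∀ k, T (e k) = κ k • e k)
    (hker : ∀ x, (∀ k, inner ℝ (e k) x = 0) → T x = 0) (x : H) :
    HasSum (fun k => κ k * (inner ℝ (e k) x)^2) (inner ℝ x (T x)) := by
  set c : ℕ → ℝ := fun k => inner ℝ (e k) x with hc
  have hsq : Summable fun k => (c k)^2 := by
    have := he.inner_products_summable x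
    simpa [hc, Real.norm_eq_abs, sq_abs] using this
  have hs : Summable fun k => c k • e k := by
    have h := (he.orthogonalFamily.summable_iff_norm_sq_summable c)
    simp only [LinearIsometry.toSpanSingleton_apply, Real.norm_eq_abs, sq_abs] at h
    exact h.2 hsq
  obtain ⟨y, hy⟩ := hs
  have horth : ∀ k, inner ℝ (e k) (x - y) = 0 := by
    intro k
    have h1 := hy.mapL (innerSL ℝ (e k))
    have h2 : HasSum (fun i => innerSL ℝ (e k) (c i • e i)) (c k) := by
      convert hasSum_ite_eq k (c k) using 2 with i
      rw [innerSL_apply_apply, inner_smul_right, orthonormal_iff_ite.1 he k i]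
      by_cases h : i = k
      · simp [h]
      · simp [h, Ne.symm h]
    have h3 := h1.unique h2
    rw [inner_sub_right]
    simp only [innerSL_apply_apply] at h3
    rw [h3, sub_self]
  have hT : T x = T y := by
    have := hker _ horth
    rwa [map_sub, sub_eq_zero] at this
  rw [hT]
  have h4 := (hy.mapL T).mapL (innerSL ℝ x)
  have hfun : (fun k => κ k * c k ^ 2) = fun k => innerSL ℝ x (T (c k • e k)) := by
    funext k
    simp only [innerSL_apply_apply, map_smul, hTe, hc,
      real_inner_comm (e k) x, smul_eq_mul]
    ring
  rw [hfun]
  exact h4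

/-- Ky Fan's maximum principle. -/
lemma sum_quadraticForm_le {T : H →L[ℝ] H} {e : ℕ → H} {κ : ℕ → ℝ}
    (he : Orthonormal ℝ e) (hTe : ∀ k, T (e k) = κ k • e k) (hκ : Antitone κ)
    (hκ0 : ∀ k, 0 ≤ κ k)
    (hker : ∀ x, (∀ k, inner ℝ (e k) x = 0) → T x = 0)
    {m : ℕ} {ψ : Fin m → H} (hψ : Orthonormal ℝ ψ) :
    ∑ i, inner ℝ (ψ i) (T (ψ i)) ≤ ∑ k : Fin m, κ k := by
  have key : ∀ x : H, inner ℝ x (T x) ≤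
      ∑ k ∈ Finset.range m, (κ k - κ m) * (inner ℝ (e k) x)^2 + κ m * ‖x‖^2 := by
    intro x
    have hsq : Summable fun k => (inner ℝ (e k) x : ℝ)^2 := by
      have := he.inner_products_summable x
      simpa [Real.norm_eq_abs, sq_abs] using this
    have hb : ∑' k, (inner ℝ (e k) x : ℝ)^2 ≤ ‖x‖^2 := by
      have := he.tsum_inner_products_le x
      simpa [Real.norm_eq_abs, sq_abs] using this
    have h1 := hasSum_quadraticForm he hTe hker x
    have h2 := (hasSum_sum_of_ne_finset_zero
      (f := fun k => if k < m then (κ k - κ m) * (inner ℝ (e k) x)^2 else 0) (s := Finset.range m)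
      (by intro b hb; simp at hb; simp [not_lt.2 hb])).add (hsq.hasSum.mul_left (κ m))
    refine (hasSum_le ?_ h1 h2).trans ?_
    · intro k
      split_ifs with hk
      · exact le_of_eq (by ring)
      · rw [zero_add]
        exact mul_le_mul_of_nonneg_right (hκ (not_lt.1 hk)) (sq_nonneg _)
    · refine add_le_add (le_of_eq (Finset.sum_congr rfl ?_)) 
        (mul_le_mul_of_nonneg_left hb (hκ0 m))
      intro k hk
      simp [Finset.mem_range.1 hk]
  have hbes : ∀ k, ∑ i, (inner ℝ (e k) (ψ i) : ℝ)^2 ≤ 1 := by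
    intro k
    have := hψ.sum_inner_products_le (e k) (s := Finset.univ)
    rw [he.1 k] at this
    simpa [Real.norm_eq_abs, sq_abs, real_inner_comm] using this
  calc ∑ i, inner ℝ (ψ i) (T (ψ i)) ≤ ∑ i, (∑ k ∈ Finset.range m,
          (κ k - κ m) * (inner ℝ (e k) (ψ i))^2 + κ m * ‖ψ i‖^2) :=
        Finset.sum_le_sum fun i _ => key _
    _ = ∑ k ∈ Finset.range m, (κ k - κ m) * ∑ i, (inner ℝ (e k) (ψ i))^2 + m * κ m := by
        rw [Finset.sum_add_distrib, Finset.sum_comm]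
        simp [hψ.1, Finset.mul_sum]
    _ ≤ ∑ k ∈ Finset.range m, (κ k - κ m) * 1 + m * κ m := by
        gcongr with k hk
        · exact sub_nonneg.2 (hκ (Finset.mem_range.1 hk).le)
        · exact hbes k
    _ = ∑ k : Fin m, κ k := by
        rw [Fin.sum_univ_eq_sum_range]
        simp

/-- Abel summation: dominated partial sums stay dominated after weighting by a nonnegative
antitone sequence. -/
lemma mul_sum_sub_le_sum_mul_sub (κ : ℕ → ℝ) : ∀ {n : ℕ} {t μ : Fin n → ℝ}, Antitone μ →
    (∀ i, 0 ≤ μ i) →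
    (∀ (m : ℕ) (hm : m ≤ n), ∑ i : Fin m, t (Fin.castLE hm i) ≤ ∑ i : Fin m, κ i) →
    ∀ c, (∀ i, c ≤ μ i) → c * ∑ i : Fin n, (κ i - t i) ≤ ∑ i, μ i * (κ i - t i)
  | 0, _, _, _, _, _, _, _ => by simp
  | n + 1, t, μ, hμ, hμ0, ht, c, hc => by
      have ih := mul_sum_sub_le_sum_mul_sub κ (n := n) (t := fun i => t i.castSucc)
        (μ := fun i => μ i.castSucc) (fun i j hij => hμ (by simpa using hij))
        (fun i => hμ0 _) (fun m hm => ht m (hm.trans n.le_succ)) (μ (Fin.last n))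
        (fun i => hμ (Fin.le_last _))
      have hD : 0 ≤ ∑ i : Fin (n + 1), (κ i - t i) := by
        rw [Finset.sum_sub_distrib, sub_nonneg]
        exact ht (n + 1) le_rfl
      calc c * ∑ i : Fin (n + 1), (κ i - t i) ≤ μ (Fin.last n) * ∑ i : Fin (n + 1), (κ i - t i) :=
            mul_le_mul_of_nonneg_right (hc _) hD
        _ ≤ _ := by
            rw [Fin.sum_univ_castSucc, Fin.sum_univ_castSucc, mul_add]
            simpa using ih

lemma sum_mul_quadraticForm_le {T : H →L[ℝ] H} {e : ℕ → H} {κ : ℕ → ℝ}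
    (he : Orthonormal ℝ e) (hTe : ∀ k, T (e k) = κ k • e k) (hκ : Antitone κ)
    (hκ0 : ∀ k, 0 ≤ κ k)
    (hker : ∀ x, (∀ k, inner ℝ (e k) x = 0) → T x = 0)
    {n : ℕ} {ψ : Fin n → H} (hψ : Orthonormal ℝ ψ) {μ : Fin n → ℝ} (hμ : Antitone μ)
    (hμ0 : ∀ i, 0 ≤ μ i) :
    ∑ i, μ i * inner ℝ (ψ i) (T (ψ i)) ≤ ∑ i : Fin n, μ i * κ i := by
  have := mul_sum_sub_le_sum_mul_sub κ (t := fun i => inner ℝ (ψ i) (T (ψ i))) hμ hμ0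
    (fun m hm => sum_quadraticForm_le he hTe hκ hκ0 hker
      (hψ.comp _ (Fin.castLE_injective hm))) 0 hμ0
  simp only [mul_sub, Finset.sum_sub_distrib] at this
  linarith

/-- The eigenvectors for nonzero eigenvalues of a compact symmetric operator exhaust the
complement of its kernel. -/
lemma eq_zero_of_orthogonal_eigenvectors {T : H →L[ℝ] H} (hT : IsCompactOperator T)
    (hsym : (T : H →ₗ[ℝ] H).IsSymmetric) {e : ℕ → H}
    (hspan : ∀ (κ : ℝ) (f : H), κ ≠ 0 → f ≠ 0 → T f = κ • f → ∃ k, ∃ c : ℝ, f = c • e k)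
    (x : H) (hx : ∀ k, inner ℝ (e k) x = 0) : T x = 0 := by
  have h := ContinuousLinearMap.orthogonalComplement_iSup_eigenspaces_eq_bot hT hsym
  suffices hmem : T x ∈ (⨆ μ, Module.End.eigenspace (T : Module.End ℝ H) μ)ᗮ by
    rwa [h, Submodule.mem_bot] at hmem
  rw [← Submodule.iInf_orthogonal, Submodule.mem_iInf]
  intro κ
  rw [Submodule.mem_orthogonal]
  intro f hf
  rw [Module.End.mem_eigenspace_iff] at hf
  have hf' : T f = κ • f := hf
  have h1 : inner ℝ f (T x) = κ * inner ℝ f x := by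
    have := hsym f x
    rw [ContinuousLinearMap.coe_coe, hf', real_inner_smul_left] at this
    exact this.symm
  rw [h1]
  by_cases hκ : κ = 0
  · simp [hκ]
  by_cases hf0 : f = 0
  · simp [hf0]
  obtain ⟨k, c, rfl⟩ := hspan κ f hκ hf0 hf'
  simp [inner_smul_left, hx k]

end SpectralInequalities

section GreenKernel

lemma Kgreen_eq_min_max (x y : ℝ) :
    Kgreen x y = (1/6) * (1 - max x y)^2 * (min x y)^2 *
      (3 * max x y - min x y - 2 * min x y * max x y) := by
  unfold Kgreen
  split_ifs with h
  · rw [max_eq_left h, min_eq_right h]; ring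
  · rw [max_eq_right (not_le.1 h).le, min_eq_left (not_le.1 h).le]; ring

lemma Kgreen_symm (x y : ℝ) : Kgreen x y = Kgreen y x := by
  rw [Kgreen_eq_min_max, Kgreen_eq_min_max, max_comm, min_comm]

lemma continuous_Kgreen : Continuous fun p : ℝ × ℝ => Kgreen p.1 p.2 := by
  simp only [Kgreen_eq_min_max]
  fun_prop

lemma Kgreen_lipschitz {x y x' y' : ℝ} (hx : x ∈ Icc (0:ℝ) 1) (hy : y ∈ Icc (0:ℝ) 1)
    (hx' : x' ∈ Icc (0:ℝ) 1) (hy' : y' ∈ Icc (0:ℝ) 1) {δ : ℝ} (h1 : |x - x'| ≤ δ)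
    (h2 : |y - y'| ≤ δ) : |Kgreen x y - Kgreen x' y'| ≤ 5 * δ := by
  have hmax : |max x y - max x' y'| ≤ δ := (abs_max_sub_max_le_max _ _ _ _).trans (max_le h1 h2)
  have hmin : |min x y - min x' y'| ≤ δ := (abs_min_sub_min_le_max _ _ _ _).trans (max_le h1 h2)
  have key : ∀ a a' b b' : ℝ, a ∈ Icc (0:ℝ) 1 → a' ∈ Icc (0:ℝ) 1 → b ∈ Icc (0:ℝ) 1 →
      b' ∈ Icc (0:ℝ) 1 → |a - a'| ≤ δ → |b - b'| ≤ δ →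
      |(1/6) * (1 - b)^2 * a^2 * (3 * b - a - 2 * a * b)
        - (1/6) * (1 - b')^2 * a'^2 * (3 * b' - a' - 2 * a' * b')| ≤ 5 * δ := by
    intro a a' b b' ha ha' hb hb' hda hdb
    have lip : ∀ (f f' : ℝ → ℝ) (c : ℝ), (∀ t, HasDerivAt f (f' t) t) →
        (∀ t ∈ Icc (0:ℝ) 1, |f' t| ≤ c) → ∀ s ∈ Icc (0:ℝ) 1, ∀ t ∈ Icc (0:ℝ) 1,
        |f s - f t| ≤ c * |s - t| := by
      intro f f' c hf hc s hs t ht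
      have := (convex_Icc (0:ℝ) 1).norm_image_sub_le_of_norm_hasDerivWithin_le
        (f := f) (f' := f') (C := c) (fun x _ => (hf x).hasDerivWithinAt)
        (fun x hx => hc x hx) ht hs
      simpa using this
    have e1 := lip (fun t => (1/6) * (1 - b)^2 * t^2 * (3 * b - t - 2 * t * b))
      (fun t => (1/6) * (1 - b)^2 * (2 * t * (3 * b - t - 2 * t * b) + t^2 * (-1 - 2 * b))) 2
      (fun t => by
        have hid := hasDerivAt_id t
        refine (((hid.pow 2).const_mul ((1/6) * (1 - b)^2)).mul
          ((hid.const_sub (3 * b)).sub ((hid.const_mul 2).mul_const b))).congr_deriv ?_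
        simp; ring)
      (fun t ht => by
        have hb1 : (1 - b)^2 ≤ 1 := by nlinarith [hb.1, hb.2]
        have hb0 : 0 ≤ (1 - b)^2 := sq_nonneg _
        have ht1 : |2 * t * (3 * b - t - 2 * t * b) + t^2 * (-1 - 2 * b)| ≤ 12 := by
          have := mul_nonneg ht.1 hb.1
          have h3 := mul_nonneg (mul_nonneg ht.1 ht.1) hb.1
          have h4 := mul_le_mul ht.2 hb.2 hb.1 zero_le_one
          have h5 := mul_le_mul ht.2 ht.2 ht.1 zero_le_one
          have h6 := mul_le_mul h5 hb.2 hb.1 (by norm_num)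
          rw [abs_le]; constructor <;> nlinarith
        rw [abs_mul, abs_of_nonneg (by positivity)]
        nlinarith [abs_nonneg (2 * t * (3 * b - t - 2 * t * b) + t^2 * (-1 - 2 * b))])
      a ha a' ha'
    have e2 := lip (fun t => (1/6) * (1 - t)^2 * a'^2 * (3 * t - a' - 2 * a' * t))
      (fun t => (1/6) * a'^2 * (-2 * (1 - t) * (3 * t - a' - 2 * a' * t)
        + (1 - t)^2 * (3 - 2 * a'))) 3
      (fun t => by
        have hid := hasDerivAt_id t
        refine (((((hid.const_sub 1).pow 2).const_mul (1/6)).mul_const (a'^2)).mul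
          (((hid.const_mul 3).sub_const a').sub (hid.const_mul (2 * a')))).congr_deriv ?_
        simp; ring)
      (fun t ht => by
        have hb1 : a'^2 ≤ 1 := by nlinarith [ha'.1, ha'.2]
        have hb0 : 0 ≤ a'^2 := sq_nonneg _
        have ht1 : |-2 * (1 - t) * (3 * t - a' - 2 * a' * t) + (1 - t)^2 * (3 - 2 * a')| ≤ 18 := by
          have u1 : |1 - t| ≤ 1 := by rw [abs_le]; constructor <;> linarith [ht.1, ht.2]
          have u2 : |3 * t - a' - 2 * a' * t| ≤ 3 := by
            rw [abs_le]; constructor <;> nlinarith [ht.1, ht.2, ha'.1, ha'.2, mul_nonneg ha'.1 ht.1,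
              mul_nonneg (sub_nonneg.2 ha'.2) (sub_nonneg.2 ht.2)]
          have u3 : |3 - 2 * a'| ≤ 3 := by
            rw [abs_le]; constructor <;> linarith [ha'.1, ha'.2]
          refine (abs_add_le _ _).trans ?_
          rw [abs_mul, abs_mul, abs_mul, abs_pow, abs_neg, abs_two]
          have v1 := mul_le_mul u1 u2 (abs_nonneg _) zero_le_one
          have v2 := mul_le_mul (pow_le_one₀ (n := 2) (abs_nonneg _) u1) u3 (abs_nonneg _) zero_le_one
          linarith
        rw [abs_mul, abs_of_nonneg (by positivity)]
        nlinarith [abs_nonneg (-2 * (1 - t) * (3 * t - a' - 2 * a' * t)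
          + (1 - t)^2 * (3 - 2 * a'))])
      b hb b' hb'
    have := abs_add_le _ _ |>.trans (add_le_add e1 e2)
    refine le_trans (le_of_eq ?_) (this.trans ?_)
    · congr 1; ring
    · linarith
  rw [Kgreen_eq_min_max, Kgreen_eq_min_max]
  refine key _ _ _ _ ?_ ?_ ?_ ?_ hmin hmax
  · exact ⟨le_min hx.1 hy.1, (min_le_left _ _).trans hx.2⟩
  · exact ⟨le_min hx'.1 hy'.1, (min_le_left _ _).trans hx'.2⟩
  · exact ⟨hx.1.trans (le_max_left _ _), max_le hx.2 hy.2⟩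
  · exact ⟨hx'.1.trans (le_max_left _ _), max_le hx'.2 hy'.2⟩

lemma Kgreen_zero_left {y : ℝ} (hy : 0 ≤ y) : Kgreen 0 y = 0 := by
  rw [Kgreen_eq_min_max, min_eq_left hy]; ring

lemma Kgreen_one_left {y : ℝ} (hy : y ≤ 1) : Kgreen 1 y = 0 := by
  rw [Kgreen_eq_min_max, max_eq_left hy]; ring

lemma abs_Kgreen_le {x y : ℝ} (hx : x ∈ Icc (0:ℝ) 1) (hy : y ∈ Icc (0:ℝ) 1) :
    |Kgreen x y| ≤ 5 := by
  have := Kgreen_lipschitz hx hy (x' := 0) (y' := y) (by simp) hy (δ := 1)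
    (by rw [abs_le]; constructor <;> linarith [hx.1, hx.2]) (by simp)
  rw [Kgreen_zero_left hy.1] at this
  simpa using this

/-- The second derivative of Green's kernel in its second variable. -/
noncomputable def greenSnd (x t : ℝ) : ℝ :=
  (1 - x)^2 * (x - (1 + 2 * x) * t) + max (t - x) 0

lemma greenSnd_of_le {x t : ℝ} (h : t ≤ x) : greenSnd x t = (1 - x)^2 * (x - (1 + 2 * x) * t) := by
  rw [greenSnd, max_eq_right (by linarith), add_zero]

lemma greenSnd_of_ge {x t : ℝ} (h : x ≤ t) :
    greenSnd x t = (1 - x)^2 * (x - (1 + 2 * x) * t) + (t - x) := by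
  rw [greenSnd, max_eq_left (by linarith)]

lemma continuous_greenSnd (x : ℝ) : Continuous (greenSnd x) := by
  unfold greenSnd
  fun_prop

/-- Green's kernel is a Gram kernel. -/
lemma integral_greenSnd_mul {x y : ℝ} (hx : x ∈ Icc (0:ℝ) 1) (hy : y ∈ Icc (0:ℝ) 1) :
    ∫ t in (0:ℝ)..1, greenSnd x t * greenSnd y t = Kgreen x y := by
  wlog h : y ≤ x generalizing x y
  · rw [Kgreen_symm, ← this hy hx (not_le.1 h).le]
    simp only [mul_comm]
  have hint : ∀ a b, IntervalIntegrable (fun t => greenSnd x t * greenSnd y t) volume a b :=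
    fun a b => ((continuous_greenSnd x).mul (continuous_greenSnd y)).intervalIntegrable a b
  have quad : ∀ a b p q r s : ℝ, ∫ t in a..b, (p + q * t) * (r + s * t)
      = (p * r * b + (p * s + q * r) * b^2 / 2 + q * s * b^3 / 3)
        - (p * r * a + (p * s + q * r) * a^2 / 2 + q * s * a^3 / 3) := by
    intro a b p q r s
    refine intervalIntegral.integral_eq_sub_of_hasDerivAt
      (f := fun t => p * r * t + (p * s + q * r) * t^2 / 2 + q * s * t^3 / 3) (fun t _ => ?_)
      (Continuous.intervalIntegrable (by fun_prop) a b)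
    have hid := hasDerivAt_id t
    refine (((hid.const_mul (p * r)).add
      (((hid.pow 2).const_mul (p * s + q * r)).div_const 2)).add
      (((hid.pow 3).const_mul (q * s)).div_const 3)).congr_deriv ?_
    simp; ring
  rw [← intervalIntegral.integral_add_adjacent_intervals (hint 0 y) (hint y 1),
    ← intervalIntegral.integral_add_adjacent_intervals (hint y x) (hint x 1)]
  rw [intervalIntegral.integral_congr (a := 0) (b := y) (g := fun t =>
      ((1 - x)^2 * x + (-(1 - x)^2 * (1 + 2 * x)) * t) *
      ((1 - y)^2 * y + (-(1 - y)^2 * (1 + 2 * y)) * t)), 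
    intervalIntegral.integral_congr (a := y) (b := x) (g := fun t =>
      ((1 - x)^2 * x + (-(1 - x)^2 * (1 + 2 * x)) * t) *
      (((1 - y)^2 * y - y) + (1 - (1 - y)^2 * (1 + 2 * y)) * t)),
    intervalIntegral.integral_congr (a := x) (b := 1) (g := fun t =>
      (((1 - x)^2 * x - x) + (1 - (1 - x)^2 * (1 + 2 * x)) * t) *
      (((1 - y)^2 * y - y) + (1 - (1 - y)^2 * (1 + 2 * y)) * t)), quad, quad, quad]
  · rw [Kgreen, if_pos h]; ring
  · intro t ht
    rw [uIcc_of_le hx.2] at ht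
    simp only [greenSnd_of_ge ht.1, greenSnd_of_ge (h.trans ht.1)]; ring
  · intro t ht
    rw [uIcc_of_le h] at ht
    simp only [greenSnd_of_le ht.2, greenSnd_of_ge ht.1]; ring
  · intro t ht
    rw [uIcc_of_le hy.1] at ht
    simp only [greenSnd_of_le ht.2, greenSnd_of_le (ht.2.trans h)]; ring

lemma Kgreen_posSemidef {ι : Type*} (s : Finset ι) (c x : ι → ℝ)
    (hx : ∀ i, x i ∈ Icc (0:ℝ) 1) : 0 ≤ ∑ i ∈ s, ∑ j ∈ s, c i * c j * Kgreen (x i) (x j) := by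
  have h : ∑ i ∈ s, ∑ j ∈ s, c i * c j * Kgreen (x i) (x j)
      = ∫ t in (0:ℝ)..1, (∑ i ∈ s, c i * greenSnd (x i) t)^2 := by
    have hc : ∀ i, Continuous (greenSnd (x i)) := fun i => continuous_greenSnd _
    have hexp : ∀ t, (∑ i ∈ s, c i * greenSnd (x i) t)^2 =
        ∑ i ∈ s, ∑ j ∈ s, c i * c j * (greenSnd (x i) t * greenSnd (x j) t) := by
      intro t
      rw [sq, Finset.sum_mul_sum]
      exact Finset.sum_congr rfl fun i _ => Finset.sum_congr rfl fun j _ => by ring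
    simp only [hexp]
    rw [intervalIntegral.integral_finsetSum
      fun i _ => Continuous.intervalIntegrable (by fun_prop) _ _]
    refine Finset.sum_congr rfl fun i _ => ?_
    rw [intervalIntegral.integral_finsetSum
      fun j _ => Continuous.intervalIntegrable (by fun_prop) _ _]
    refine Finset.sum_congr rfl fun j _ => ?_
    rw [intervalIntegral.integral_const_mul, integral_greenSnd_mul (hx i) (hx j)]
  rw [h]
  exact intervalIntegral.integral_nonneg zero_le_one fun t _ => sq_nonneg _

end GreenKernel

section ClampedBeam

/-- `u` is a solution of `u⁗ = u₄` with clamped boundary conditions, with successive derivatives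
`u₁, u₂, u₃, u₄`. -/
structure IsClampedSolution (u u₁ u₂ u₃ u₄ : ℝ → ℝ) : Prop where
  deriv0 : ∀ x, HasDerivAt u (u₁ x) x
  deriv1 : ∀ x, HasDerivAt u₁ (u₂ x) x
  deriv2 : ∀ x, HasDerivAt u₂ (u₃ x) x
  deriv3 : ∀ x, HasDerivAt u₃ (u₄ x) x
  cont : Continuous u₄
  left : u 0 = 0
  left' : u₁ 0 = 0
  right : u 1 = 0
  right' : u₁ 1 = 0

lemma exists_isClampedSolution {g : ℝ → ℝ} (hg : Continuous g) :
    ∃ u u₁ u₂ u₃, IsClampedSolution u u₁ u₂ u₃ g := by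
  have prim : ∀ f : ℝ → ℝ, Continuous f → ∃ F : ℝ → ℝ, (∀ x, HasDerivAt F (f x) x) ∧
      Continuous F ∧ F 0 = 0 := by
    intro f hf
    have h : ∀ x, HasDerivAt (fun x => ∫ t in (0:ℝ)..x, f t) (f x) x := fun x =>
      (hf.integral_hasStrictDerivAt 0 x).hasDerivAt
    exact ⟨_, h, continuous_iff_continuousAt.2 fun x => (h x).continuousAt, by simp⟩
  obtain ⟨w3, h3, c3, -⟩ := prim g hg
  obtain ⟨w2, h2, c2, -⟩ := prim w3 c3
  obtain ⟨w1, h1, c1, z1⟩ := prim w2 c2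
  obtain ⟨w0, h0, c0, z0⟩ := prim w1 c1
  set b := 2 * w0 1 - w1 1 with hb
  set a := -w0 1 - b with ha
  refine ⟨fun x => w0 x + (a * x^2 + b * x^3), fun x => w1 x + (2 * a * x + 3 * b * x^2),
    fun x => w2 x + (2 * a + 6 * b * x), fun x => w3 x + 6 * b, ?_⟩
  have hid := fun x : ℝ => hasDerivAt_id x
  refine ⟨fun x => ?_, fun x => ?_, fun x => ?_, fun x => ?_, hg, ?_, ?_, ?_, ?_⟩
  · refine ((h0 x).add ((((hid x).pow 2).const_mul a).add
      (((hid x).pow 3).const_mul b))).congr_deriv ?_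
    simp; ring
  · refine ((h1 x).add (((hid x).const_mul (2 * a)).add
      (((hid x).pow 2).const_mul (3 * b)))).congr_deriv ?_
    simp; ring
  · refine ((h2 x).add (((hid x).const_mul (6 * b)).const_add (2 * a))).congr_deriv ?_
    simp
  · exact (h3 x).add_const _
  · simp [z0]
  · simp [z1]
  · simp only [ha, hb]; ring
  · simp only [ha, hb]; ring

lemma ContDiff.isClampedSolution {φ : ℝ → ℝ} (hφ : ContDiff ℝ 4 φ) (h0 : φ 0 = 0)
    (h0' : deriv φ 0 = 0) (h1 : φ 1 = 0) (h1' : deriv φ 1 = 0) :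
    IsClampedSolution φ (iteratedDeriv 1 φ) (iteratedDeriv 2 φ) (iteratedDeriv 3 φ)
      (iteratedDeriv 4 φ) := by
  have h : ∀ k : ℕ, k < 4 → ∀ x, HasDerivAt (iteratedDeriv k φ) (iteratedDeriv (k + 1) φ x) x := by
    intro k hk x
    rw [iteratedDeriv_succ]
    exact ((hφ.differentiable_iteratedDeriv k (by exact_mod_cast hk)) x).hasDerivAt
  refine ⟨fun x => ?_, h 1 (by norm_num), h 2 (by norm_num), h 3 (by norm_num),
    hφ.continuous_iteratedDeriv 4 le_rfl, h0, ?_, h1, ?_⟩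
  · simpa using h 0 (by norm_num) x
  · simpa using h0'
  · simpa using h1'

namespace IsClampedSolution

variable {u u₁ u₂ u₃ u₄ : ℝ → ℝ}

lemma contDiff (h : IsClampedSolution u u₁ u₂ u₃ u₄) : ContDiff ℝ 4 u := by
  have step : ∀ (f f' : ℝ → ℝ) (n : ℕ), (∀ x, HasDerivAt f (f' x) x) → ContDiff ℝ n f' →
      ContDiff ℝ ((n + 1 : ℕ) : WithTop ℕ∞) f := by
    intro f f' n hf hf'
    have : deriv f = f' := funext fun x => (hf x).deriv
    push_cast
    rw [contDiff_succ_iff_deriv]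
    exact ⟨fun x => (hf x).differentiableAt, by simp, this ▸ hf'⟩
  have h0 : ContDiff ℝ (0 : ℕ) u₄ := by simpa using h.cont
  exact step _ _ 3 h.deriv0 (step _ _ 2 h.deriv1 (step _ _ 1 h.deriv2 (step _ _ 0 h.deriv3 h0)))

lemma deriv_eq (h : IsClampedSolution u u₁ u₂ u₃ u₄) : deriv u = u₁ :=
  funext fun x => (h.deriv0 x).deriv

lemma iteratedDeriv_four (h : IsClampedSolution u u₁ u₂ u₃ u₄) : iteratedDeriv 4 u = u₄ := by
  have d1 : deriv u₁ = u₂ := funext fun x => (h.deriv1 x).deriv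
  have d2 : deriv u₂ = u₃ := funext fun x => (h.deriv2 x).deriv
  have d3 : deriv u₃ = u₄ := funext fun x => (h.deriv3 x).deriv
  rw [iteratedDeriv_succ, iteratedDeriv_succ, iteratedDeriv_succ, iteratedDeriv_one, h.deriv_eq,
    d1, d2, d3]

/-- Green's representation formula. -/
lemma integral_Kgreen_mul (h : IsClampedSolution u u₁ u₂ u₃ u₄) {x : ℝ}
    (hx : x ∈ Icc (0:ℝ) 1) : ∫ y in (0:ℝ)..1, Kgreen x y * u₄ y = u x := by
  have cub : ∀ a b p q r s : ℝ, ∫ y in a..b, (p + q * y + r * y^2 + s * y^3) * u₄ y =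
      ((p + q * b + r * b^2 + s * b^3) * u₃ b - (q + 2 * r * b + 3 * s * b^2) * u₂ b
        + (2 * r + 6 * s * b) * u₁ b - 6 * s * u b)
      - ((p + q * a + r * a^2 + s * a^3) * u₃ a - (q + 2 * r * a + 3 * s * a^2) * u₂ a
        + (2 * r + 6 * s * a) * u₁ a - 6 * s * u a) := by
    intro a b p q r s
    have hc := h.cont
    refine intervalIntegral.integral_eq_sub_of_hasDerivAt
      (f := fun y => (p + q * y + r * y^2 + s * y^3) * u₃ y
        - (q + 2 * r * y + 3 * s * y^2) * u₂ y + (2 * r + 6 * s * y) * u₁ y - 6 * s * u y)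
      (fun y _ => ?_) (Continuous.intervalIntegrable (by fun_prop) a b)
    have hid := hasDerivAt_id y
    have p0 : HasDerivAt (fun y => p + q * y + r * y^2 + s * y^3)
        (q + 2 * r * y + 3 * s * y^2) y := by
      refine ((((hid.const_mul q).const_add p).add ((hid.pow 2).const_mul r)).add
        ((hid.pow 3).const_mul s)).congr_deriv ?_
      simp; ring
    have p1 : HasDerivAt (fun y => q + 2 * r * y + 3 * s * y^2) (2 * r + 6 * s * y) y := by
      refine (((hid.const_mul (2 * r)).const_add q).add
        ((hid.pow 2).const_mul (3 * s))).congr_deriv ?_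
      simp; ring
    have p2 : HasDerivAt (fun y => 2 * r + 6 * s * y) (6 * s) y := by
      refine ((hid.const_mul (6 * s)).const_add (2 * r)).congr_deriv ?_
      simp
    refine ((((p0.mul (h.deriv3 y)).sub (p1.mul (h.deriv2 y))).add (p2.mul (h.deriv1 y))).sub
      ((h.deriv0 y).const_mul (6 * s))).congr_deriv ?_
    ring
  have hcont : Continuous fun y => Kgreen x y * u₄ y :=
    (continuous_Kgreen.comp (by fun_prop : Continuous fun y : ℝ => (x, y))).mul h.cont
  rw [← intervalIntegral.integral_add_adjacent_intervals (b := x)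
    (hcont.intervalIntegrable _ _) (hcont.intervalIntegrable _ _)]
  rw [intervalIntegral.integral_congr (a := 0) (b := x) (g := fun y =>
      (0 + 0 * y + ((1/6) * (1 - x)^2 * (3 * x)) * y^2
        + (-(1/6) * (1 - x)^2 * (1 + 2 * x)) * y^3) * u₄ y),
    intervalIntegral.integral_congr (a := x) (b := 1) (g := fun y =>
      (-(1/6) * x^3 + ((1/6) * x^2 * 3) * y + (((1/6) * (1 - x)^2 * (3 * x)) - x/2) * y^2
        + ((-(1/6) * (1 - x)^2 * (1 + 2 * x)) + 1/6) * y^3) * u₄ y), cub, cub,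
      h.left, h.left', h.right, h.right']
  · ring
  · intro y hy
    rw [uIcc_of_le hx.2] at hy
    simp only [Kgreen_eq_min_max, max_eq_right hy.1, min_eq_left hy.1]; ring
  · intro y hy
    rw [uIcc_of_le hx.1] at hy
    simp only [Kgreen_eq_min_max, max_eq_left hy.2, min_eq_right hy.2]; ring

end IsClampedSolution

lemma isClampedBiharmonicEV_iff {lam : ℝ} : IsClampedBiharmonicEV lam ↔
    ∃ u u₁ u₂ u₃ u₄, IsClampedSolution u u₁ u₂ u₃ u₄ ∧ (∃ x ∈ Icc (0:ℝ) 1, u x ≠ 0) ∧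
      ∀ x ∈ Icc (0:ℝ) 1, u₄ x = lam * u x := by
  constructor
  · rintro ⟨φ, hφ, hne, heq, h0, h0', h1, h1'⟩
    exact ⟨_, _, _, _, _, hφ.isClampedSolution h0 h0' h1 h1', hne, heq⟩
  · rintro ⟨u, u₁, u₂, u₃, u₄, h, hne, heq⟩
    refine ⟨u, h.contDiff, hne, ?_, h.left, ?_, h.right, ?_⟩
    · rwa [h.iteratedDeriv_four]
    · rw [h.deriv_eq, h.left']
    · rw [h.deriv_eq, h.right']

/-- Uniqueness for the initial value problem `u⁗ = lam * u`. -/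
lemma eq_zero_of_initial_zero {u u₁ u₂ u₃ u₄ : ℝ → ℝ} {lam : ℝ}
    (d0 : ∀ x, HasDerivAt u (u₁ x) x) (d1 : ∀ x, HasDerivAt u₁ (u₂ x) x)
    (d2 : ∀ x, HasDerivAt u₂ (u₃ x) x) (d3 : ∀ x, HasDerivAt u₃ (u₄ x) x)
    (heq : ∀ x ∈ Icc (0:ℝ) 1, u₄ x = lam * u x)
    (h0 : u 0 = 0) (h1 : u₁ 0 = 0) (h2 : u₂ 0 = 0) (h3 : u₃ 0 = 0) :
    ∀ x ∈ Icc (0:ℝ) 1, u x = 0 := by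
  set C : ℝ := 2 + lam^2 with hC
  let E : ℝ → ℝ := fun x => (u x^2 + u₁ x^2 + u₂ x^2 + u₃ x^2) * Real.exp (-C * x)
  have hE : ∀ x, HasDerivAt E ((2 * u x * u₁ x + 2 * u₁ x * u₂ x + 2 * u₂ x * u₃ x
      + 2 * u₃ x * u₄ x - C * (u x^2 + u₁ x^2 + u₂ x^2 + u₃ x^2)) * Real.exp (-C * x)) x := by
    intro x
    have hexp : HasDerivAt (fun x => Real.exp (-C * x)) (Real.exp (-C * x) * (-C * 1)) x :=
      ((hasDerivAt_id x).const_mul (-C)).exp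
    refine ((((((d0 x).pow 2).add ((d1 x).pow 2)).add ((d2 x).pow 2)).add
      ((d3 x).pow 2)).mul hexp).congr_deriv ?_
    simp; ring
  have hanti : AntitoneOn E (Icc 0 1) := by
    refine antitoneOn_of_deriv_nonpos (convex_Icc 0 1)
      (fun x _ => (hE x).continuousAt.continuousWithinAt)
      (fun x _ => (hE x).differentiableAt.differentiableWithinAt) fun x hx => ?_
    rw [interior_Icc] at hx
    rw [(hE x).deriv, heq x ⟨hx.1.le, hx.2.le⟩]
    refine mul_nonpos_of_nonpos_of_nonneg ?_ (Real.exp_pos _).le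
    nlinarith [sq_nonneg (u x - u₁ x), sq_nonneg (u₁ x - u₂ x), sq_nonneg (u₂ x - u₃ x),
      sq_nonneg (u₃ x - lam * u x), mul_nonneg (sq_nonneg lam) (sq_nonneg (u₁ x)),
      mul_nonneg (sq_nonneg lam) (sq_nonneg (u₂ x)), mul_nonneg (sq_nonneg lam) (sq_nonneg (u₃ x)),
      sq_nonneg (u x), sq_nonneg (u₁ x), sq_nonneg (u₂ x), sq_nonneg (u₃ x)]
  intro x hx
  have h := hanti ⟨le_rfl, zero_le_one⟩ hx hx.1
  have hE0 : E 0 = 0 := by simp [E, h0, h1, h2, h3]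
  rw [hE0] at h
  have : u x^2 + u₁ x^2 + u₂ x^2 + u₃ x^2 ≤ 0 := by
    by_contra! hcon
    exact absurd h (not_le.2 (mul_pos hcon (Real.exp_pos _)))
  nlinarith [sq_nonneg (u x), sq_nonneg (u₁ x), sq_nonneg (u₂ x), sq_nonneg (u₃ x)]

lemma IsClampedSolution.eq_zero {u u₁ u₂ u₃ u₄ : ℝ → ℝ} (h : IsClampedSolution u u₁ u₂ u₃ u₄)
    {lam : ℝ} (hlam : 0 < lam) (heq : ∀ x ∈ Icc (0:ℝ) 1, u₄ x = lam * u x) (h2 : u₂ 0 = 0) :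
    ∀ x ∈ Icc (0:ℝ) 1, u x = 0 := by
  obtain ⟨β, hβ, rfl⟩ : ∃ β : ℝ, 0 < β ∧ β^4 = lam :=
    ⟨lam ^ ((1:ℝ)/4), Real.rpow_pos_of_pos hlam _, by
      rw [← Real.rpow_natCast, ← Real.rpow_mul hlam.le]; norm_num⟩
  have lin : ∀ x, HasDerivAt (fun x => β * x) β x := fun x => by
    simpa using (hasDerivAt_id x).const_mul β
  set c := u₃ 0 / (2 * β^3) with hc
  have hv := eq_zero_of_initial_zero (lam := β^4)
    (u := fun x => u x - c * (Real.sinh (β * x) - Real.sin (β * x)))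
    (u₁ := fun x => u₁ x - c * (Real.cosh (β * x) * β - Real.cos (β * x) * β))
    (u₂ := fun x => u₂ x - c * (Real.sinh (β * x) * β * β - -Real.sin (β * x) * β * β))
    (u₃ := fun x => u₃ x - c * (Real.cosh (β * x) * β * β * β - -(Real.cos (β * x) * β) * β * β))
    (u₄ := fun x => u₄ x - c * (Real.sinh (β * x) * β * β * β * β
      - -(-Real.sin (β * x) * β * β) * β * β))
    (fun x => (h.deriv0 x).sub (((lin x).sinh.sub (lin x).sin).const_mul c))
    (fun x => (h.deriv1 x).sub
      ((((lin x).cosh.mul_const β).sub ((lin x).cos.mul_const β)).const_mul c))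
    (fun x => (h.deriv2 x).sub
      (((((lin x).sinh.mul_const β).mul_const β).sub
        ((((lin x).sin.neg).mul_const β).mul_const β)).const_mul c))
    (fun x => (h.deriv3 x).sub
      ((((((lin x).cosh.mul_const β).mul_const β).mul_const β).sub
        (((((lin x).cos.mul_const β).neg).mul_const β).mul_const β)).const_mul c))
    (fun x hx => by simp only [heq x hx]; ring)
    (by simp [h.left]) (by simp [h.left']) (by simp [h2])
    (by simp only [hc, mul_zero, Real.cosh_zero, Real.cos_zero]; field_simp; ring)
  have hc0 : c = 0 := by
    have h1 := hv 1 ⟨zero_le_one, le_rfl⟩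
    have hs := Real.sin_lt hβ
    have hsh := Real.self_lt_sinh_iff.2 hβ
    simp only [h.right, mul_one, zero_sub, neg_eq_zero, mul_eq_zero] at h1
    exact h1.resolve_right (by linarith)
  intro x hx
  simpa [hc0] using hv x hx

end ClampedBeam

section GreenOperator

/-- Lebesgue measure on the unit interval. -/
noncomputable abbrev unitMeasure : Measure ℝ := volume.restrict (Ioc 0 1)

instance : IsProbabilityMeasure unitMeasure := ⟨by simp [unitMeasure]⟩

/-- The Hilbert space of square integrable functions on the unit interval. -/
noncomputable abbrev UnitL2 := Lp ℝ 2 unitMeasure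

lemma ae_mem_unit : ∀ᵐ x ∂unitMeasure, x ∈ Icc (0:ℝ) 1 :=
  (ae_restrict_mem measurableSet_Ioc).mono fun _ hx => ⟨hx.1.le, hx.2⟩

lemma memLp_of_bounded {g : ℝ → ℝ} (hg : Measurable g) {C : ℝ}
    (hC : ∀ x ∈ Icc (0:ℝ) 1, |g x| ≤ C) : MemLp g 2 unitMeasure :=
  MemLp.of_bound hg.aestronglyMeasurable C (ae_mem_unit.mono fun x hx => by simpa using hC x hx)

lemma memLp_of_continuous {g : ℝ → ℝ} (hg : Continuous g) : MemLp g 2 unitMeasure := by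
  obtain ⟨C, hC⟩ := (isCompact_Icc (a := (0:ℝ)) (b := 1)).exists_bound_of_continuousOn
    hg.continuousOn
  exact memLp_of_bounded hg.measurable hC

lemma norm_le_of_bounded {f : UnitL2} {C : ℝ} (hC : 0 ≤ C) (h : ∀ᵐ x ∂unitMeasure, |f x| ≤ C) :
    ‖f‖ ≤ C := by
  have := Lp.norm_le_of_ae_bound (f := f) hC (by simpa using h)
  simpa [measureUnivNNReal] using this

lemma inner_toLp_left {g : ℝ → ℝ} (hg : MemLp g 2 unitMeasure) (f : UnitL2) :
    inner ℝ (hg.toLp g) f = ∫ y, g y * f y ∂unitMeasure := by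
  rw [L2.inner_def]
  refine integral_congr_ae ?_
  filter_upwards [hg.coeFn_toLp] with y hy
  rw [hy]
  simp [mul_comm]

/-- The section `K(x, ·)` of Green's kernel. -/
noncomputable def greenSection (x : ℝ) : UnitL2 :=
  (memLp_of_continuous (continuous_Kgreen.comp (by fun_prop : Continuous fun y : ℝ => (x, y)))).toLp
    (fun y => Kgreen x y)

lemma greenSection_coe (x : ℝ) : greenSection x =ᵐ[unitMeasure] fun y => Kgreen x y :=
  MemLp.coeFn_toLp _

lemma norm_greenSection_le {x : ℝ} (hx : x ∈ Icc (0:ℝ) 1) : ‖greenSection x‖ ≤ 5 := by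
  refine norm_le_of_bounded (by norm_num) ?_
  filter_upwards [greenSection_coe x, ae_mem_unit] with y hy hy'
  rw [hy]
  exact abs_Kgreen_le hx hy'

/-- Truncation of the real line to the unit interval. -/
noncomputable def clampUnit (x : ℝ) : ℝ := max 0 (min x 1)

lemma clampUnit_mem (x : ℝ) : clampUnit x ∈ Icc (0:ℝ) 1 :=
  ⟨le_max_left _ _, max_le zero_le_one (min_le_right _ _)⟩

lemma clampUnit_of_mem {x : ℝ} (hx : x ∈ Icc (0:ℝ) 1) : clampUnit x = x := by
  rw [clampUnit, min_eq_left hx.2, max_eq_right hx.1]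

lemma abs_clampUnit_sub_le (x y : ℝ) : |clampUnit x - clampUnit y| ≤ |x - y| := by
  refine (abs_max_sub_max_le_max _ _ _ _).trans (max_le (by simp) ?_)
  exact (abs_min_sub_min_le_max _ _ _ _).trans (max_le le_rfl (by simp))

/-- The continuous representative of the Green potential of `f`. -/
noncomputable def greenPotential (f : UnitL2) (x : ℝ) : ℝ :=
  inner ℝ (greenSection (clampUnit x)) f

lemma greenPotential_eq_inner (f : UnitL2) {x : ℝ} (hx : x ∈ Icc (0:ℝ) 1) :
    greenPotential f x = inner ℝ (greenSection x) f := by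
  rw [greenPotential, clampUnit_of_mem hx]

lemma greenPotential_eq_integral (f : UnitL2) {x : ℝ} (hx : x ∈ Icc (0:ℝ) 1) :
    greenPotential f x = ∫ y, Kgreen x y * f y ∂unitMeasure := by
  rw [greenPotential_eq_inner f hx, greenSection, inner_toLp_left]

lemma continuous_greenPotential (f : UnitL2) : Continuous (greenPotential f) := by
  have h : LipschitzWith 5 fun x => greenSection (clampUnit x) := by
    refine LipschitzWith.of_dist_le_mul fun x y => ?_
    rw [dist_eq_norm]
    refine norm_le_of_bounded (by positivity) ?_
    filter_upwards [Lp.coeFn_sub (greenSection (clampUnit x)) (greenSection (clampUnit y)),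
      greenSection_coe (clampUnit x), greenSection_coe (clampUnit y), ae_mem_unit] with z h1 h2 h3 hz
    rw [h1, Pi.sub_apply, h2, h3]
    refine (Kgreen_lipschitz (clampUnit_mem x) hz (clampUnit_mem y) hz
      (abs_clampUnit_sub_le x y) (by simp)).trans (le_of_eq ?_)
    simp [Real.dist_eq]
  exact h.continuous.inner continuous_const

/-- The inverse of the clamped biharmonic operator. -/
noncomputable def greenOp : UnitL2 →L[ℝ] UnitL2 :=
  LinearMap.mkContinuous
    { toFun := fun f => (memLp_of_continuous (continuous_greenPotential f)).toLp (greenPotential f)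
      map_add' := fun f g => by
        rw [← MemLp.toLp_add]
        congr 1
        funext x
        exact inner_add_right _ _ _
      map_smul' := fun c f => by
        rw [RingHom.id_apply, ← MemLp.toLp_const_smul]
        congr 1
        funext x
        exact inner_smul_right _ _ _ } 5
    fun f => by
      refine norm_le_of_bounded (by positivity) ?_
      filter_upwards [(memLp_of_continuous (continuous_greenPotential f)).coeFn_toLp] with x hx
      refine (congrArg abs hx).trans_le ((abs_real_inner_le_norm _ _).trans ?_)
      exact mul_le_mul_of_nonneg_right (norm_greenSection_le (clampUnit_mem x)) (norm_nonneg _)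

lemma greenOp_coe (f : UnitL2) : greenOp f =ᵐ[unitMeasure] greenPotential f :=
  (memLp_of_continuous (continuous_greenPotential f)).coeFn_toLp

lemma IsClampedSolution.greenPotential_eq {u u₁ u₂ u₃ u₄ : ℝ → ℝ}
    (h : IsClampedSolution u u₁ u₂ u₃ u₄) {f : UnitL2} (hf : f =ᵐ[unitMeasure] u₄) {x : ℝ}
    (hx : x ∈ Icc (0:ℝ) 1) : greenPotential f x = u x := by
  rw [greenPotential_eq_integral f hx, ← h.integral_Kgreen_mul hx,
    intervalIntegral.integral_of_le zero_le_one]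
  exact integral_congr_ae (hf.mono fun y hy => by simp only [hy])

/-- Eigenvectors of the Green operator are eigenfunctions of the clamped biharmonic operator. -/
lemma exists_isClampedSolution_of_eigenvector {κ : ℝ} {f : UnitL2} (hκ : κ ≠ 0)
    (hf : greenOp f = κ • f) : ∃ u u₁ u₂ u₃ u₄, IsClampedSolution u u₁ u₂ u₃ u₄ ∧
      f =ᵐ[unitMeasure] u₄ ∧ ∀ x ∈ Icc (0:ℝ) 1, u₄ x = κ⁻¹ * u x := by
  have hcont : Continuous fun x => κ⁻¹ * greenPotential f x :=
    (continuous_greenPotential f).const_mul _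
  obtain ⟨u, u₁, u₂, u₃, h⟩ := exists_isClampedSolution hcont
  have hfu : f =ᵐ[unitMeasure] fun x => κ⁻¹ * greenPotential f x := by
    filter_upwards [greenOp_coe f, Lp.coeFn_smul κ f] with x h1 h2
    rw [← h1, hf, h2, Pi.smul_apply, smul_eq_mul, inv_mul_cancel_left₀ hκ]
  exact ⟨u, u₁, u₂, u₃, _, h, hfu, fun x hx => by rw [h.greenPotential_eq hfu hx]⟩

lemma eq_zero_of_ae_eq_clamped {u u₄ : ℝ → ℝ} {lam : ℝ} {f : UnitL2} (hf : f =ᵐ[unitMeasure] u₄)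
    (heq : ∀ x ∈ Icc (0:ℝ) 1, u₄ x = lam * u x) (hu : ∀ x ∈ Icc (0:ℝ) 1, u x = 0) : f = 0 := by
  refine (Lp.eq_zero_iff_ae_eq_zero).2 ?_
  filter_upwards [hf, ae_mem_unit] with x h1 hx
  rw [h1, heq x hx, hu x hx, mul_zero, Pi.zero_apply]

lemma isClampedBiharmonicEV_of_eigenvector {κ : ℝ} {f : UnitL2} (hκ : κ ≠ 0) (hf0 : f ≠ 0)
    (hf : greenOp f = κ • f) : IsClampedBiharmonicEV κ⁻¹ := by
  obtain ⟨u, u₁, u₂, u₃, u₄, h, hfu, heq⟩ := exists_isClampedSolution_of_eigenvector hκ hf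
  refine isClampedBiharmonicEV_iff.2 ⟨u, u₁, u₂, u₃, u₄, h, ?_, heq⟩
  by_contra! hu
  exact hf0 (eq_zero_of_ae_eq_clamped hfu heq hu)

/-- The eigenvalues of the clamped biharmonic operator are simple. -/
lemma exists_smul_of_eigenvectors {κ : ℝ} (hκ : 0 < κ) {f g : UnitL2} (hf0 : f ≠ 0)
    (hf : greenOp f = κ • f) (hg : greenOp g = κ • g) : ∃ c : ℝ, g = c • f := by
  obtain ⟨u, u₁, u₂, u₃, u₄, hu, hfu, hequ⟩ := exists_isClampedSolution_of_eigenvector hκ.ne' hf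
  obtain ⟨w, w₁, w₂, w₃, w₄, hw, hgw, heqw⟩ := exists_isClampedSolution_of_eigenvector hκ.ne' hg
  have hu2 : u₂ 0 ≠ 0 := fun h0 =>
    hf0 (eq_zero_of_ae_eq_clamped hfu hequ (hu.eq_zero (inv_pos.2 hκ) hequ h0))
  set c := w₂ 0 / u₂ 0 with hc
  have hv : IsClampedSolution (fun x => w x - c * u x) (fun x => w₁ x - c * u₁ x)
      (fun x => w₂ x - c * u₂ x) (fun x => w₃ x - c * u₃ x) (fun x => w₄ x - c * u₄ x) :=
    { deriv0 := fun x => (hw.deriv0 x).sub ((hu.deriv0 x).const_mul c)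
      deriv1 := fun x => (hw.deriv1 x).sub ((hu.deriv1 x).const_mul c)
      deriv2 := fun x => (hw.deriv2 x).sub ((hu.deriv2 x).const_mul c)
      deriv3 := fun x => (hw.deriv3 x).sub ((hu.deriv3 x).const_mul c)
      cont := hw.cont.sub (hu.cont.const_mul c)
      left := by simp [hu.left, hw.left]
      left' := by simp [hu.left', hw.left']
      right := by simp [hu.right, hw.right]
      right' := by simp [hu.right', hw.right'] }
  have heqv : ∀ x ∈ Icc (0:ℝ) 1, w₄ x - c * u₄ x = κ⁻¹ * (w x - c * u x) := fun x hx => by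
    rw [hequ x hx, heqw x hx]; ring
  refine ⟨c, sub_eq_zero.1 (eq_zero_of_ae_eq_clamped (f := g - c • f) ?_ heqv
    (hv.eq_zero (inv_pos.2 hκ) heqv ?_))⟩
  · filter_upwards [hfu, hgw, Lp.coeFn_sub g (c • f), Lp.coeFn_smul c f] with x h1 h2 h3 h4
    rw [h3, Pi.sub_apply, h4, Pi.smul_apply, h1, h2, smul_eq_mul]
  · simp [hc, hu2]

/-- Clamped biharmonic eigenfunctions are eigenvectors of the Green operator. -/
lemma exists_eigenvector_of_isClampedBiharmonicEV {lam : ℝ} (hlam : lam ≠ 0)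
    (h : IsClampedBiharmonicEV lam) : ∃ f : UnitL2, ‖f‖ = 1 ∧ greenOp f = lam⁻¹ • f := by
  obtain ⟨u, u₁, u₂, u₃, u₄, hu, ⟨x, hx, hux⟩, heq⟩ := isClampedBiharmonicEV_iff.1 h
  set f : UnitL2 := (memLp_of_continuous hu.cont).toLp u₄ with hf
  have hfu : f =ᵐ[unitMeasure] u₄ := (memLp_of_continuous hu.cont).coeFn_toLp
  have hTf : greenOp f = lam⁻¹ • f := by
    refine Lp.ext ?_
    filter_upwards [greenOp_coe f, Lp.coeFn_smul lam⁻¹ f, hfu, ae_mem_unit] with y h1 h2 h3 hy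
    rw [h1, h2, Pi.smul_apply, h3, hu.greenPotential_eq hfu hy, heq y hy, smul_eq_mul,
      inv_mul_cancel_left₀ hlam]
  have hf0 : f ≠ 0 := by
    intro h0
    refine hux ?_
    rw [← hu.greenPotential_eq hfu hx, h0, greenPotential, inner_zero_right]
  refine ⟨‖f‖⁻¹ • f, norm_smul_inv_norm hf0, ?_⟩
  rw [map_smul, hTf, smul_comm]

end GreenOperator

section StepFunctions

/-- The step function with values `√N * w i` on the cell around the grid point `(i + 1) / N`. -/
noncomputable def gridStep (N : ℕ) (w : Fin (N - 1) → ℝ) (x : ℝ) : ℝ :=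
  √N * ∑ i : Fin (N - 1), if round ((N : ℝ) * x) = (i : ℕ) + 1 then w i else 0

lemma gridStep_of_round_eq {N : ℕ} (w : Fin (N - 1) → ℝ) {x : ℝ} {i : Fin (N - 1)}
    (h : round ((N : ℝ) * x) = (i : ℕ) + 1) : gridStep N w x = √N * w i := by
  rw [gridStep, Finset.sum_eq_single i]
  · rw [if_pos h]
  · intro j _ hj
    rw [if_neg]
    rw [h]
    intro h'
    exact hj (Fin.ext (by omega))
  · simp

lemma gridStep_of_round_ne {N : ℕ} (w : Fin (N - 1) → ℝ) {x : ℝ}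
    (h : ∀ i : Fin (N - 1), round ((N : ℝ) * x) ≠ (i : ℕ) + 1) : gridStep N w x = 0 := by
  simp [gridStep, h]

lemma measurable_round_mul (N : ℕ) : Measurable fun x : ℝ => round ((N : ℝ) * x) := by
  simp only [round_eq]
  exact Int.measurable_floor.comp (by fun_prop)

lemma measurable_gridStep (N : ℕ) (w : Fin (N - 1) → ℝ) : Measurable (gridStep N w) := by
  unfold gridStep
  refine (Finset.measurable_sum _ fun i _ => ?_).const_mul _
  exact Measurable.ite (measurable_round_mul N (measurableSet_singleton _)) measurable_const
    measurable_const

lemma exists_abs_gridStep_le (N : ℕ) (w : Fin (N - 1) → ℝ) : ∃ C, ∀ x, |gridStep N w x| ≤ C := by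
  refine ⟨√N * ∑ i, |w i|, fun x => ?_⟩
  rw [gridStep, abs_mul, abs_of_nonneg (Real.sqrt_nonneg _)]
  refine mul_le_mul_of_nonneg_left ((Finset.abs_sum_le_sum_abs _ _).trans
    (Finset.sum_le_sum fun i _ => ?_)) (Real.sqrt_nonneg _)
  split_ifs <;> simp

lemma memLp_gridStep (N : ℕ) (w : Fin (N - 1) → ℝ) : MemLp (gridStep N w) 2 unitMeasure := by
  obtain ⟨C, hC⟩ := exists_abs_gridStep_le N w
  exact memLp_of_bounded (measurable_gridStep N w) fun x _ => hC x

lemma measure_cell {N : ℕ} (i : Fin (N - 1)) :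
    unitMeasure.real {x | round ((N : ℝ) * x) = (i : ℕ) + 1} = 1 / N := by
  have hi : (i : ℕ) + 2 ≤ N := by have := i.2; omega
  have hi' : ((i : ℕ) : ℝ) + 2 ≤ N := by exact_mod_cast hi
  have hi0 : (0 : ℝ) ≤ (i : ℕ) := Nat.cast_nonneg _
  have hN : (0 : ℝ) < N := by linarith
  have hset : {x : ℝ | round ((N : ℝ) * x) = (i : ℕ) + 1} ∩ Ioc 0 1
      = Ico ((i + 1 / 2) / N : ℝ) ((i + 3 / 2) / N) := by
    ext x
    simp only [mem_inter_iff, Set.mem_ofPred_eq, round_eq, Int.floor_eq_iff, mem_Ico, mem_Ioc,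
      div_le_iff₀ hN, lt_div_iff₀ hN]
    push_cast
    constructor
    · rintro ⟨⟨h1, h2⟩, -⟩
      constructor <;> linarith
    · rintro ⟨h1, h2⟩
      refine ⟨⟨by linarith, by linarith⟩, ?_, ?_⟩
      · by_contra! h
        nlinarith
      · by_contra! h
        nlinarith
  have hm : MeasurableSet {x : ℝ | round ((N : ℝ) * x) = (i : ℕ) + 1} :=
    measurable_round_mul N (measurableSet_singleton _)
  rw [measureReal_restrict_apply hm, hset,
    Real.volume_real_Ico_of_le (by gcongr; norm_num)]
  field_simp
  ring

lemma integral_gridStep_mul (N : ℕ) (w w' : Fin (N - 1) → ℝ) :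
    ∫ x, gridStep N w x * gridStep N w' x ∂unitMeasure = ∑ i, w i * w' i := by
  have hmeas : ∀ i : Fin (N - 1), MeasurableSet {x : ℝ | round ((N : ℝ) * x) = (i : ℕ) + 1} :=
    fun i => measurable_round_mul N (measurableSet_singleton _)
  have h : ∀ x, gridStep N w x * gridStep N w' x = ∑ i : Fin (N - 1),
      {x : ℝ | round ((N : ℝ) * x) = (i : ℕ) + 1}.indicator (fun _ => N * (w i * w' i)) x := by
    intro x
    by_cases hx : ∃ i : Fin (N - 1), round ((N : ℝ) * x) = (i : ℕ) + 1
    · obtain ⟨i, hi⟩ := hx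
      rw [gridStep_of_round_eq w hi, gridStep_of_round_eq w' hi, Finset.sum_eq_single i]
      · rw [indicator_of_mem (by exact hi)]
        linear_combination (w i * w' i) * Real.mul_self_sqrt (Nat.cast_nonneg (α := ℝ) N)
      · intro j _ hj
        refine indicator_of_notMem (fun h' => hj (Fin.ext ?_)) _
        have : round ((N : ℝ) * x) = (j : ℕ) + 1 := h'
        omega
      · simp
    · push Not at hx
      rw [gridStep_of_round_ne w hx, zero_mul, Finset.sum_eq_zero]
      exact fun j _ => indicator_of_notMem
        (show x ∉ {x : ℝ | round ((N : ℝ) * x) = (j : ℕ) + 1} from hx j) _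
  simp only [h]
  rw [integral_finsetSum _ fun i _ => (integrable_const _).indicator (hmeas i)]
  refine Finset.sum_congr rfl fun i _ => ?_
  rw [integral_indicator_const _ (hmeas i), measure_cell, smul_eq_mul]
  have hN : (N : ℝ) ≠ 0 := by
    have := i.2
    exact_mod_cast (by omega : N ≠ 0)
  field_simp

lemma round_mul_mem {N : ℕ} (hN : 0 < N) {x : ℝ} (hx : x ∈ Icc (0:ℝ) 1) :
    0 ≤ round ((N : ℝ) * x) ∧ round ((N : ℝ) * x) ≤ N := by
  have hN' : (0 : ℝ) < N := by exact_mod_cast hN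
  have h := abs_le.1 (abs_sub_round ((N : ℝ) * x))
  have h1 : (0 : ℝ) ≤ N * x := mul_nonneg hN'.le hx.1
  have h2 : (N : ℝ) * x ≤ N := by nlinarith [hx.2]
  constructor
  · have : (-1 : ℝ) < round ((N : ℝ) * x) := by linarith [h.2]
    have : (-1 : ℤ) < round ((N : ℝ) * x) := by exact_mod_cast this
    omega
  · have : (round ((N : ℝ) * x) : ℝ) < N + 1 := by linarith [h.1]
    have : round ((N : ℝ) * x) < N + 1 := by exact_mod_cast this
    omega

lemma round_div_mem {N : ℕ} (hN : 0 < N) {x : ℝ} (hx : x ∈ Icc (0:ℝ) 1) :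
    (round ((N : ℝ) * x) : ℝ) / N ∈ Icc (0:ℝ) 1 := by
  have hN' : (0 : ℝ) < N := by exact_mod_cast hN
  have h := round_mul_mem hN hx
  refine ⟨div_nonneg (by exact_mod_cast h.1) hN'.le, (div_le_one hN').2 (by exact_mod_cast h.2)⟩

lemma abs_sub_round_div_le {N : ℕ} (hN : 0 < N) (x : ℝ) :
    |x - (round ((N : ℝ) * x) : ℝ) / N| ≤ 1 / N := by
  have hN' : (0 : ℝ) < N := by exact_mod_cast hN
  have h := abs_sub_round ((N : ℝ) * x)
  have : x - (round ((N : ℝ) * x) : ℝ) / N = (N * x - round ((N : ℝ) * x)) / N := by field_simp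
  rw [this, abs_div, abs_of_pos hN']
  gcongr
  linarith

lemma abs_Kgreen_sub_Kpc_le {N : ℕ} (hN : 0 < N) {x y : ℝ} (hx : x ∈ Icc (0:ℝ) 1)
    (hy : y ∈ Icc (0:ℝ) 1) : |Kgreen x y - Kpc N x y| ≤ 5 * (1 / N) :=
  Kgreen_lipschitz hx hy (round_div_mem hN hx) (round_div_mem hN hy) (abs_sub_round_div_le hN x)
    (abs_sub_round_div_le hN y)

lemma measurable_Kpc (N : ℕ) : Measurable fun p : ℝ × ℝ => Kpc N p.1 p.2 := by
  unfold Kpc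
  have h : Measurable fun x : ℝ => ((round ((N : ℝ) * x) : ℤ) : ℝ) / N :=
    ((measurable_of_countable _).comp (measurable_round_mul N)).div_const _
  exact continuous_Kgreen.measurable.comp
    ((h.comp measurable_fst).prodMk (h.comp measurable_snd))

lemma Kmat_isHermitian (N : ℕ) : (Kmat N).IsHermitian := by
  ext i j
  simp [Kmat, Kgreen_symm]

lemma sum_sq_eigenvectorBasis {N : ℕ} (hsym : (Kmat N).IsHermitian) (l m : Fin (N - 1)) :
    ∑ i, hsym.eigenvectorBasis l i * hsym.eigenvectorBasis m i = if l = m then 1 else 0 := by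
  have h := orthonormal_iff_ite.1 hsym.eigenvectorBasis.orthonormal l m
  rw [← h, PiLp.inner_apply]
  exact Finset.sum_congr rfl fun i _ => by simp [mul_comm]

lemma sum_Kmat_mul_eigenvectorBasis {N : ℕ} (hsym : (Kmat N).IsHermitian) (i l : Fin (N - 1)) :
    ∑ k, Kmat N i k * hsym.eigenvectorBasis l k =
      hsym.eigenvalues l * hsym.eigenvectorBasis l i := by
  have h := congrFun (hsym.mulVec_eigenvectorBasis l) i
  simpa [Matrix.mulVec, dotProduct] using h

lemma Kmat_apply_eq_sum {N : ℕ} (hsym : (Kmat N).IsHermitian) (i j : Fin (N - 1)) : Kmat N i j =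
    ∑ l, hsym.eigenvalues l * (hsym.eigenvectorBasis l i * hsym.eigenvectorBasis l j) := by
  have hrepr : ∀ k, (∑ l, hsym.eigenvectorBasis l j * hsym.eigenvectorBasis l k)
      = if k = j then 1 else 0 := by
    intro k
    have h := congrArg (fun v => v k)
      (hsym.eigenvectorBasis.sum_repr (EuclideanSpace.single j (1:ℝ)))
    simpa [OrthonormalBasis.repr_apply_apply, EuclideanSpace.inner_single_right,
      PiLp.single_apply] using h
  calc Kmat N i j = ∑ k, Kmat N i k * if k = j then 1 else 0 := by simp
    _ = ∑ l, (∑ k, Kmat N i k * hsym.eigenvectorBasis l k) * hsym.eigenvectorBasis l j := by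
        simp only [← hrepr, Finset.mul_sum, Finset.sum_mul]
        rw [Finset.sum_comm]
        exact Finset.sum_congr rfl fun l _ => Finset.sum_congr rfl fun k _ => by ring
    _ = _ := Finset.sum_congr rfl fun l _ => by rw [sum_Kmat_mul_eigenvectorBasis]; ring

lemma Kmat_eigenvalues_nonneg {N : ℕ} (hsym : (Kmat N).IsHermitian) (l : Fin (N - 1)) :
    0 ≤ hsym.eigenvalues l := by
  have h1 : hsym.eigenvalues l = ∑ i, hsym.eigenvectorBasis l i *
      ∑ k, Kmat N i k * hsym.eigenvectorBasis l k := by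
    calc hsym.eigenvalues l = hsym.eigenvalues l *
          ∑ i, hsym.eigenvectorBasis l i * hsym.eigenvectorBasis l i := by
            rw [sum_sq_eigenvectorBasis, if_pos rfl, mul_one]
      _ = _ := by
        rw [Finset.mul_sum]
        exact Finset.sum_congr rfl fun i _ => by rw [sum_Kmat_mul_eigenvectorBasis]; ring
  have h2 := Kgreen_posSemidef Finset.univ (hsym.eigenvectorBasis l)
    (fun i : Fin (N - 1) => ((i : ℕ) + 1 : ℝ) / N) fun i => by
      have hi : ((i : ℕ) : ℝ) + 1 ≤ N := by
        have := i.2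
        exact_mod_cast (by omega : (i : ℕ) + 1 ≤ N)
      exact ⟨by positivity, div_le_one_of_le₀ hi (Nat.cast_nonneg _)⟩
  rw [h1]
  refine (mul_nonneg (by positivity : (0 : ℝ) ≤ 1 / N) h2).trans_eq ?_
  simp only [Finset.mul_sum, Kmat]
  exact Finset.sum_congr rfl fun i _ => Finset.sum_congr rfl fun j _ => by ring

lemma Kpc_eq_sum {N : ℕ} (hsym : (Kmat N).IsHermitian) (hN : 0 < N) {x y : ℝ} (hx : x ∈ Icc (0:ℝ) 1) (hy : y ∈ Icc (0:ℝ) 1) :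
    Kpc N x y = ∑ l, hsym.eigenvalues l * (gridStep N (hsym.eigenvectorBasis l) x
      * gridStep N (hsym.eigenvectorBasis l) y) := by
  have hN' : (N : ℝ) ≠ 0 := by exact_mod_cast hN.ne'
  have out : ∀ z ∈ Icc (0:ℝ) 1, (¬ ∃ i : Fin (N - 1), round ((N : ℝ) * z) = (i : ℕ) + 1) →
      (round ((N : ℝ) * z) : ℝ) / N = 0 ∨ (round ((N : ℝ) * z) : ℝ) / N = 1 := by
    intro z hz h
    obtain ⟨h0, h1⟩ := round_mul_mem hN hz
    by_cases hz0 : round ((N : ℝ) * z) = 0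
    · left; simp [hz0]
    by_cases hz1 : round ((N : ℝ) * z) = N
    · right; rw [hz1]; push_cast; exact div_self hN'
    · refine absurd ⟨⟨(round ((N : ℝ) * z) - 1).toNat, by omega⟩, ?_⟩ h
      simp only
      omega
  have zero : ∀ s t : ℝ, s ∈ Icc (0:ℝ) 1 → (t = 0 ∨ t = 1) → Kgreen t s = 0 := by
    rintro s t hs (rfl | rfl)
    · exact Kgreen_zero_left hs.1
    · exact Kgreen_one_left hs.2
  by_cases hi : ∃ i : Fin (N - 1), round ((N : ℝ) * x) = (i : ℕ) + 1
  · by_cases hj : ∃ j : Fin (N - 1), round ((N : ℝ) * y) = (j : ℕ) + 1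
    · obtain ⟨i, hi⟩ := hi
      obtain ⟨j, hj⟩ := hj
      have h1 : Kpc N x y = N * Kmat N i j := by
        rw [Kpc, Kmat, hi, hj]
        push_cast
        field_simp
      rw [h1, Kmat_apply_eq_sum hsym, Finset.mul_sum]
      refine Finset.sum_congr rfl fun l _ => ?_
      rw [gridStep_of_round_eq _ hi, gridStep_of_round_eq _ hj]
      linear_combination (-(hsym.eigenvalues l * (hsym.eigenvectorBasis l i *
        hsym.eigenvectorBasis l j))) * Real.mul_self_sqrt (Nat.cast_nonneg (α := ℝ) N)
    · rw [Kpc, Kgreen_symm, zero _ _ (round_div_mem hN hx) (out y hy hj), Finset.sum_eq_zero]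
      intro l _
      rw [gridStep_of_round_ne _ (x := y) (by push Not at hj; exact hj), mul_zero, mul_zero]
  · rw [Kpc, zero _ _ (round_div_mem hN hy) (out x hx hi), Finset.sum_eq_zero]
    intro l _
    rw [gridStep_of_round_ne _ (x := x) (by push Not at hi; exact hi), zero_mul, mul_zero]

end StepFunctions

section Compactness

open Filter Topology

/-- The normalized eigenvectors of `Kmat N` as step functions in `L²`. -/
noncomputable def stepVec {N : ℕ} (hsym : (Kmat N).IsHermitian) (l : Fin (N - 1)) : UnitL2 :=
  (memLp_gridStep N (hsym.eigenvectorBasis l)).toLp _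

lemma stepVec_coe {N : ℕ} (hsym : (Kmat N).IsHermitian) (l : Fin (N - 1)) :
    stepVec hsym l =ᵐ[unitMeasure] gridStep N (hsym.eigenvectorBasis l) :=
  MemLp.coeFn_toLp _

lemma orthonormal_stepVec {N : ℕ} (hsym : (Kmat N).IsHermitian) : Orthonormal ℝ (stepVec hsym) := by
  rw [orthonormal_iff_ite]
  intro l m
  rw [stepVec, inner_toLp_left, ← sum_sq_eigenvectorBasis hsym, ← integral_gridStep_mul]
  exact integral_congr_ae ((stepVec_coe hsym m).mono fun x hx => by simp only [hx])

/-- The section `K_h(x, ·)` of the piecewise constant kernel. -/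
noncomputable def stepSection {N : ℕ} (hsym : (Kmat N).IsHermitian) (x : ℝ) : UnitL2 :=
  ∑ l, (hsym.eigenvalues l * gridStep N (hsym.eigenvectorBasis l) x) • stepVec hsym l

lemma stepSection_coe {N : ℕ} (hsym : (Kmat N).IsHermitian) (hN : 0 < N) {x : ℝ}
    (hx : x ∈ Icc (0:ℝ) 1) : stepSection hsym x =ᵐ[unitMeasure] fun y => Kpc N x y := by
  have h1 : stepSection hsym x =ᵐ[unitMeasure] fun y => ∑ l,
      (hsym.eigenvalues l * gridStep N (hsym.eigenvectorBasis l) x) * stepVec hsym l y := by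
    unfold stepSection
    refine (Lp.coeFn_finsetSum _ _).trans ?_
    have h2 := ae_all_iff.2 fun l => Lp.coeFn_smul
      (hsym.eigenvalues l * gridStep N (hsym.eigenvectorBasis l) x) (stepVec hsym l)
    filter_upwards [h2] with y hy
    simp only [Finset.sum_apply]
    exact Finset.sum_congr rfl fun l _ => by rw [hy l, Pi.smul_apply, smul_eq_mul]
  filter_upwards [h1, ae_all_iff.2 fun l => stepVec_coe hsym l, ae_mem_unit] with y hy h2 hy'
  rw [hy, Kpc_eq_sum hsym hN hx hy']
  exact Finset.sum_congr rfl fun l _ => by rw [h2 l]; ring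

lemma greenSection_sub_stepSection_coe {N : ℕ} (hsym : (Kmat N).IsHermitian) (hN : 0 < N) {x : ℝ}
    (hx : x ∈ Icc (0:ℝ) 1) : (greenSection x - stepSection hsym x : UnitL2) =ᵐ[unitMeasure]
      fun y => Kgreen x y - Kpc N x y := by
  filter_upwards [Lp.coeFn_sub (greenSection x) (stepSection hsym x), greenSection_coe x,
    stepSection_coe hsym hN hx] with y h1 h2 h3
  rw [h1, Pi.sub_apply, h2, h3]

lemma integrable_coe_mul_coe (f g : UnitL2) : Integrable (fun x => f x * g x) unitMeasure := by
  simpa [mul_comm] using L2.integrable_inner (𝕜 := ℝ) f g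

lemma integral_coe_mul_coe (f g : UnitL2) : ∫ x, f x * g x ∂unitMeasure = inner ℝ f g := by
  simp [L2.inner_def, mul_comm]

lemma norm_greenSection_sub_stepSection_sq {N : ℕ} (hsym : (Kmat N).IsHermitian) (hN : 0 < N)
    {x : ℝ} (hx : x ∈ Icc (0:ℝ) 1) : ‖greenSection x - stepSection hsym x‖ ^ 2
      = ∫ y, (Kgreen x y - Kpc N x y) ^ 2 ∂unitMeasure := by
  rw [← real_inner_self_eq_norm_sq, ← integral_coe_mul_coe]
  refine integral_congr_ae ?_
  filter_upwards [greenSection_sub_stepSection_coe hsym hN hx] with y hy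
  rw [hy]
  ring

lemma norm_greenSection_sub_stepSection_le {N : ℕ} (hsym : (Kmat N).IsHermitian) (hN : 0 < N)
    {x : ℝ} (hx : x ∈ Icc (0:ℝ) 1) : ‖greenSection x - stepSection hsym x‖ ≤ 5 * (1 / N) := by
  refine norm_le_of_bounded (by positivity) ?_
  filter_upwards [greenSection_sub_stepSection_coe hsym hN hx, ae_mem_unit] with y hy hy'
  rw [hy]
  exact abs_Kgreen_sub_Kpc_le hN hx hy'

/-- The finite rank integral operator with kernel `Kpc N`. -/
noncomputable def stepOp {N : ℕ} (hsym : (Kmat N).IsHermitian) : UnitL2 →L[ℝ] UnitL2 :=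
  ∑ l, hsym.eigenvalues l • (innerSL ℝ (stepVec hsym l)).smulRight (stepVec hsym l)

lemma stepOp_apply {N : ℕ} (hsym : (Kmat N).IsHermitian) (f : UnitL2) : stepOp hsym f =
    ∑ l, (hsym.eigenvalues l * inner ℝ (stepVec hsym l) f) • stepVec hsym l := by
  simp [stepOp, smul_smul]

lemma stepOp_coe {N : ℕ} (hsym : (Kmat N).IsHermitian) (f : UnitL2) :
    stepOp hsym f =ᵐ[unitMeasure] fun x => inner ℝ (stepSection hsym x) f := by
  rw [stepOp_apply]
  refine (Lp.coeFn_finsetSum _ _).trans ?_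
  have h := ae_all_iff.2 fun l => Lp.coeFn_smul
    (hsym.eigenvalues l * inner ℝ (stepVec hsym l) f) (stepVec hsym l)
  filter_upwards [h, ae_all_iff.2 fun l => stepVec_coe hsym l] with x hx hx'
  rw [stepSection, sum_inner, Finset.sum_apply]
  refine Finset.sum_congr rfl fun l _ => ?_
  rw [hx l, Pi.smul_apply, hx' l, inner_smul_left, smul_eq_mul, conj_trivial]
  ring

lemma norm_greenOp_sub_stepOp_le {N : ℕ} (hsym : (Kmat N).IsHermitian) (hN : 0 < N) :
    ‖greenOp - stepOp hsym‖ ≤ 5 * (1 / N) := by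
  refine ContinuousLinearMap.opNorm_le_bound _ (by positivity) fun f => ?_
  refine norm_le_of_bounded (by positivity) ?_
  filter_upwards [Lp.coeFn_sub (greenOp f) (stepOp hsym f), greenOp_coe f, stepOp_coe hsym f,
    ae_mem_unit] with x h1 h2 h3 hx
  rw [_root_.sub_apply, h1, Pi.sub_apply, h2, h3, greenPotential_eq_inner f hx,
    ← inner_sub_left]
  exact (abs_real_inner_le_norm _ _).trans (mul_le_mul_of_nonneg_right
    (norm_greenSection_sub_stepSection_le hsym hN hx) (norm_nonneg _))

lemma tendsto_stepOp :
    Tendsto (fun N : ℕ => stepOp (Kmat_isHermitian N)) atTop (𝓝 greenOp) := by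
  rw [tendsto_iff_norm_sub_tendsto_zero]
  have h : Tendsto (fun N : ℕ => 5 * (1 / (N : ℝ))) atTop (𝓝 0) := by
    simpa using (tendsto_one_div_atTop_nhds_zero_nat (𝕜 := ℝ)).const_mul 5
  refine squeeze_zero' (Eventually.of_forall fun _ => norm_nonneg _) ?_ h
  filter_upwards [eventually_gt_atTop 0] with N hN
  rw [norm_sub_rev]
  exact norm_greenOp_sub_stepOp_le _ hN

lemma isCompactOperator_stepOp {N : ℕ} (hsym : (Kmat N).IsHermitian) :
    IsCompactOperator (stepOp hsym) := by
  refine Submodule.sum_mem (compactOperator (RingHom.id ℝ) UnitL2 UnitL2) fun l _ =>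
    Submodule.smul_mem _ _ ?_
  exact (isCompactOperator_of_locallyCompactSpace_dom (innerSL ℝ (stepVec hsym l))).clm_comp
    ((1 : ℝ →L[ℝ] ℝ).smulRight (stepVec hsym l))

lemma isCompactOperator_greenOp : IsCompactOperator greenOp :=
  isCompactOperator_of_tendsto tendsto_stepOp
    (Eventually.of_forall fun _ => isCompactOperator_stepOp _)

lemma stepOp_inner_comm {N : ℕ} (hsym : (Kmat N).IsHermitian) (f g : UnitL2) :
    inner ℝ (stepOp hsym f) g = inner ℝ f (stepOp hsym g) := by
  rw [stepOp_apply, stepOp_apply, sum_inner, inner_sum]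
  refine Finset.sum_congr rfl fun l _ => ?_
  rw [inner_smul_left, inner_smul_right, conj_trivial, real_inner_comm f]
  ring

lemma isSymmetric_greenOp : (greenOp : UnitL2 →ₗ[ℝ] UnitL2).IsSymmetric := by
  intro f g
  have h1 : Tendsto (fun N : ℕ => inner ℝ (stepOp (Kmat_isHermitian N) f) g) atTop
      (𝓝 (inner ℝ (greenOp f) g)) :=
    ((ContinuousLinearMap.apply ℝ UnitL2 f).continuous.tendsto _ |>.comp tendsto_stepOp).inner
      tendsto_const_nhds
  have h2 : Tendsto (fun N : ℕ => inner ℝ f (stepOp (Kmat_isHermitian N) g)) atTop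
      (𝓝 (inner ℝ f (greenOp g))) :=
    tendsto_const_nhds.inner
      ((ContinuousLinearMap.apply ℝ UnitL2 g).continuous.tendsto _ |>.comp tendsto_stepOp)
  exact tendsto_nhds_unique h1 (h2.congr fun N => (stepOp_inner_comm _ f g).symm)

end Compactness

section CollectiveEstimate

/-- Pointwise Bessel inequality for the error of a finite rank approximation. -/
lemma sum_sq_sub_le_norm_sub_sq {H : Type*} [NormedAddCommGroup H] [InnerProductSpace ℝ H]
    {e : ℕ → H} (he : Orthonormal ℝ e) {m : ℕ} {ψ : Fin m → H} (hψ : Orthonormal ℝ ψ)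
    (g : H) (a : Fin m → ℝ) (n : ℕ) :
    ∑ k ∈ Finset.range n, (inner ℝ (e k) g) ^ 2 - 2 * ∑ l, a l * inner ℝ (ψ l) g
      + ∑ l, a l ^ 2 ≤ ‖g - ∑ l, a l • ψ l‖ ^ 2 := by
  have h1 := he.sum_inner_products_le (s := Finset.range n) g
  have h2 : ‖∑ l, a l • ψ l‖ ^ 2 = ∑ l, a l ^ 2 := by
    rw [← real_inner_self_eq_norm_sq, hψ.inner_sum]
    simp [sq]
  have h3 : inner ℝ g (∑ l, a l • ψ l) = ∑ l, a l * inner ℝ (ψ l) g := by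
    rw [inner_sum]
    exact Finset.sum_congr rfl fun l _ => by rw [inner_smul_right, real_inner_comm]
  rw [norm_sub_sq_real, h2, h3]
  simp only [Real.norm_eq_abs, sq_abs] at h1
  linarith

lemma integrable_integral_sub_sq {N : ℕ} (hN : 0 < N) :
    Integrable (fun x => ∫ y, (Kgreen x y - Kpc N x y) ^ 2 ∂unitMeasure) unitMeasure := by
  have hm : StronglyMeasurable fun p : ℝ × ℝ => (Kgreen p.1 p.2 - Kpc N p.1 p.2) ^ 2 :=
    ((continuous_Kgreen.measurable.sub (measurable_Kpc N)).pow_const 2).stronglyMeasurable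
  refine Integrable.of_bound (hm.integral_prod_right (ν := unitMeasure)).aestronglyMeasurable
    ((5 * (1 / N)) ^ 2) ?_
  filter_upwards [ae_mem_unit] with x hx
  rw [← norm_greenSection_sub_stepSection_sq (Kmat_isHermitian N) hN hx, norm_pow, norm_norm]
  exact pow_le_pow_left₀ (norm_nonneg _) (norm_greenSection_sub_stepSection_le _ hN hx) 2

lemma greenOp_eigenvector_inner_greenSection {κ : ℝ} {f : UnitL2} (hf : greenOp f = κ • f) :
    ∀ᵐ x ∂unitMeasure, inner ℝ f (greenSection x) = κ * f x := by
  filter_upwards [greenOp_coe f, Lp.coeFn_smul κ f, ae_mem_unit] with x h1 h2 hx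
  rw [real_inner_comm, ← greenPotential_eq_inner f hx, ← h1, hf, h2, Pi.smul_apply, smul_eq_mul]

/-- The Hilbert–Schmidt distance controls the truncated sums of eigenvalues. -/
lemma sum_sq_sub_le_integral {e : ℕ → UnitL2} (he : Orthonormal ℝ e) {κ : ℕ → ℝ}
    (hTe : ∀ k, greenOp (e k) = κ k • e k) {N : ℕ} (hsym : (Kmat N).IsHermitian) (hN : 0 < N)
    (n : ℕ) :
    ∑ k ∈ Finset.range n, κ k ^ 2
      - 2 * ∑ l, hsym.eigenvalues l * inner ℝ (stepVec hsym l) (greenOp (stepVec hsym l))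
      + ∑ l, hsym.eigenvalues l ^ 2
      ≤ ∫ x, (∫ y, (Kgreen x y - Kpc N x y) ^ 2 ∂unitMeasure) ∂unitMeasure := by
  set ψ := stepVec hsym with hψ
  set ev := hsym.eigenvalues with hev
  have hpt : ∀ᵐ x ∂unitMeasure, ∑ k ∈ Finset.range n, κ k ^ 2 * (e k x * e k x)
      - 2 * ∑ l, ev l * (ψ l x * greenOp (ψ l) x) + ∑ l, ev l ^ 2 * (ψ l x * ψ l x)
      ≤ ∫ y, (Kgreen x y - Kpc N x y) ^ 2 ∂unitMeasure := by
    filter_upwards [ae_all_iff.2 fun k => greenOp_eigenvector_inner_greenSection (hTe k),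
      ae_all_iff.2 fun l => greenOp_coe (ψ l), ae_all_iff.2 fun l => stepVec_coe hsym l,
      ae_mem_unit] with x h1 h2 h3 hx
    rw [← norm_greenSection_sub_stepSection_sq hsym hN hx]
    refine le_trans (le_of_eq ?_) (sum_sq_sub_le_norm_sub_sq he (orthonormal_stepVec hsym)
      (greenSection x) (fun l => ev l * gridStep N (hsym.eigenvectorBasis l) x) n)
    congr 1
    · congr 1
      · exact Finset.sum_congr rfl fun k _ => by rw [h1 k]; ring
      · congr 1
        refine Finset.sum_congr rfl fun l _ => ?_
        rw [h2 l, greenPotential_eq_inner _ hx, hψ, h3 l, real_inner_comm (stepVec hsym l)]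
        ring
    · exact Finset.sum_congr rfl fun l _ => by rw [hψ, h3 l]; ring
  have i1 : Integrable (fun x => ∑ k ∈ Finset.range n, κ k ^ 2 * (e k x * e k x)) unitMeasure :=
    integrable_finsetSum _ fun k _ => (integrable_coe_mul_coe _ _).const_mul _
  have i2 : Integrable (fun x => ∑ l, ev l * (ψ l x * greenOp (ψ l) x)) unitMeasure :=
    integrable_finsetSum _ fun l _ => (integrable_coe_mul_coe _ _).const_mul _
  have i3 : Integrable (fun x => ∑ l, ev l ^ 2 * (ψ l x * ψ l x)) unitMeasure :=
    integrable_finsetSum _ fun l _ => (integrable_coe_mul_coe _ _).const_mul _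
  have i12 : Integrable (fun x => ∑ k ∈ Finset.range n, κ k ^ 2 * (e k x * e k x)
      - 2 * ∑ l, ev l * (ψ l x * greenOp (ψ l) x)) unitMeasure := i1.sub (i2.const_mul 2)
  refine le_trans (le_of_eq ?_) (integral_mono_ae (i12.add i3) (integrable_integral_sub_sq hN) hpt)
  simp only [Pi.add_apply]
  rw [integral_add i12 i3, integral_sub i1 (i2.const_mul 2), integral_const_mul,
    integral_finsetSum _ fun k _ => (integrable_coe_mul_coe _ _).const_mul _,
    integral_finsetSum _ fun l _ => (integrable_coe_mul_coe _ _).const_mul _,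
    integral_finsetSum _ fun l _ => (integrable_coe_mul_coe _ _).const_mul _]
  simp only [integral_const_mul, integral_coe_mul_coe, real_inner_self_eq_norm_sq, he.1,
    (orthonormal_stepVec hsym).1, hψ, one_pow, mul_one]

/-- The eigenfunctions of the clamped biharmonic operator diagonalize the Green operator. -/
lemma exists_orthonormal_eigenvectors {lam : ℕ → ℝ} (hmono : StrictMono lam)
    (hpos : ∀ k, 0 < lam k) (hev : ∀ k, IsClampedBiharmonicEV (lam k))
    (hall : ∀ μ : ℝ, IsClampedBiharmonicEV μ → ∃ k, μ = lam k) :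
    ∃ e : ℕ → UnitL2, Orthonormal ℝ e ∧ (∀ k, greenOp (e k) = (lam k)⁻¹ • e k) ∧
      ∀ x, (∀ k, inner ℝ (e k) x = 0) → greenOp x = 0 := by
  choose e he1 hTe using fun k =>
    exists_eigenvector_of_isClampedBiharmonicEV (hpos k).ne' (hev k)
  refine ⟨e, ⟨he1, fun k l hkl => ?_⟩, hTe,
    eq_zero_of_orthogonal_eigenvectors isCompactOperator_greenOp isSymmetric_greenOp ?_⟩
  · have h : inner ℝ (greenOp (e k)) (e l) = inner ℝ (e k) (greenOp (e l)) :=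
      isSymmetric_greenOp (e k) (e l)
    rw [hTe, hTe, inner_smul_left, inner_smul_right, conj_trivial] at h
    have hne : (lam k)⁻¹ - (lam l)⁻¹ ≠ 0 :=
      sub_ne_zero.2 fun h' => hkl (hmono.injective (inv_injective h'))
    exact (mul_eq_zero.1 (by linear_combination h :
      ((lam k)⁻¹ - (lam l)⁻¹) * inner ℝ (e k) (e l) = 0)).resolve_left hne
  · intro κ f hκ hf0 hf
    obtain ⟨k, hk⟩ := hall _ (isClampedBiharmonicEV_of_eigenvector hκ hf0 hf)
    have hκ' : κ = (lam k)⁻¹ := by rw [← hk, inv_inv]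
    refine ⟨k, exists_smul_of_eigenvectors (inv_pos.2 (hpos k)) ?_ (hTe k) (hκ' ▸ hf)⟩
    intro h0
    simpa [h0] using he1 k

lemma intervalIntegral_sub_sq_eq (N : ℕ) :
    ∫ x in (0:ℝ)..1, ∫ y in (0:ℝ)..1, (Kgreen x y - Kpc N x y) ^ 2
      = ∫ x, (∫ y, (Kgreen x y - Kpc N x y) ^ 2 ∂unitMeasure) ∂unitMeasure := by
  simp only [intervalIntegral.integral_of_le zero_le_one]

lemma integral_sub_sq_le {N : ℕ} (hN : 0 < N) :
    ∫ x, (∫ y, (Kgreen x y - Kpc N x y) ^ 2 ∂unitMeasure) ∂unitMeasure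
      ≤ 25 * ((1:ℝ) / N) ^ 2 := by
  have h : ∫ _ : ℝ, 25 * ((1:ℝ) / N) ^ 2 ∂unitMeasure = 25 * ((1:ℝ) / N) ^ 2 := by simp
  rw [← h]
  refine integral_mono_ae (integrable_integral_sub_sq hN) (integrable_const _) ?_
  filter_upwards [ae_mem_unit] with x hx
  rw [← norm_greenSection_sub_stepSection_sq (Kmat_isHermitian N) hN hx]
  refine (pow_le_pow_left₀ (norm_nonneg _)
    (norm_greenSection_sub_stepSection_le (Kmat_isHermitian N) hN hx) 2).trans_eq ?_
  ring

/-- A square summation inequality for all truncations gives the full estimate. -/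
lemma sum_sq_sub_add_tsum_le {κ : ℕ → ℝ} {m : ℕ} {μ : Fin m → ℝ} {I : ℝ}
    (h : ∀ n, ∑ k ∈ Finset.range n, κ k ^ 2 - 2 * ∑ i : Fin m, μ i * κ i + ∑ i, μ i ^ 2 ≤ I) :
    ∑ i : Fin m, |κ i - μ i| ^ 2 + ∑' k, κ (k + m) ^ 2 ≤ I := by
  have hs : Summable fun k => κ k ^ 2 := by
    refine summable_of_sum_range_le (c := I + 2 * ∑ i : Fin m, μ i * κ i - ∑ i, μ i ^ 2)
      (fun k => sq_nonneg _) fun n => ?_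
    linarith [h n]
  have h1 : ∑' k, κ k ^ 2 ≤ I + 2 * ∑ i : Fin m, μ i * κ i - ∑ i, μ i ^ 2 :=
    Real.tsum_le_of_sum_range_le (fun k => sq_nonneg _) fun n => by linarith [h n]
  rw [← hs.sum_add_tsum_nat_add m, ← Fin.sum_univ_eq_sum_range (fun k => κ k ^ 2)] at h1
  have h2 : ∑ i : Fin m, |κ i - μ i| ^ 2
      = ∑ i : Fin m, κ i ^ 2 - 2 * ∑ i : Fin m, μ i * κ i + ∑ i, μ i ^ 2 := by
    rw [Finset.mul_sum, ← Finset.sum_sub_distrib, ← Finset.sum_add_distrib]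
    exact Finset.sum_congr rfl fun i _ => by rw [sq_abs]; ring
  rw [h2]
  linarith

end CollectiveEstimate

/-- Collective quadratic estimate for all eigenvalue differences: if `0 < λ₁ < λ₂ < ⋯`
enumerates the eigenvalues of the clamped biharmonic operator (here `lam k = λ_{k+1}`)
and `μ_1 ≥ ⋯ ≥ μ_{N-1}` are the eigenvalues of `K^h` in decreasing order, then
`Σ_{k=1}^{N-1} |λ_k⁻¹ - μ_k|² + Σ_{k=N}^∞ λ_k⁻² ≤ ∫₀¹∫₀¹ |K - K_h|²`, and
`∫₀¹∫₀¹ |K - K_h|² ≤ C·h²` with `C` independent of `h`. -/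
theorem collective_eigenvalue_estimate
    (lam : ℕ → ℝ) (hmono : StrictMono lam) (hpos : ∀ k, 0 < lam k)
    (hev : ∀ k, IsClampedBiharmonicEV (lam k))
    (hall : ∀ μ : ℝ, IsClampedBiharmonicEV μ → ∃ k, μ = lam k) :
    (∀ N : ℕ, 2 ≤ N → ∀ (hsym : (Kmat N).IsHermitian) (μ : Fin (N-1) → ℝ),
      (∀ i j : Fin (N-1), i ≤ j → μ j ≤ μ i) →
      (∃ σ : Equiv.Perm (Fin (N-1)), ∀ i, μ i = hsym.eigenvalues (σ i)) →
      (∑ k : Fin (N-1), |(lam (k : ℕ))⁻¹ - μ k|^2)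
          + (∑' k : ℕ, ((lam (k + (N-1)))⁻¹)^2)
        ≤ ∫ x in (0:ℝ)..1, ∫ y in (0:ℝ)..1, (Kgreen x y - Kpc N x y)^2) ∧
    (∃ C > (0:ℝ), ∀ N : ℕ, 2 ≤ N →
      (∫ x in (0:ℝ)..1, ∫ y in (0:ℝ)..1, (Kgreen x y - Kpc N x y)^2)
        ≤ C * ((1:ℝ)/N)^2) := by
  refine ⟨fun N hN hsym μ hμ ⟨σ, hσ⟩ => ?_, 25, by norm_num, fun N hN => ?_⟩
  · have hN0 : 0 < N := by omega
    rw [intervalIntegral_sub_sq_eq]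
    obtain ⟨e, he, hTe, hker⟩ := exists_orthonormal_eigenvectors hmono hpos hev hall
    refine sum_sq_sub_add_tsum_le (κ := fun k => (lam k)⁻¹) fun n => ?_
    have h1 := sum_sq_sub_le_integral he hTe hsym hN0 n
    have hanti : Antitone fun k => (lam k)⁻¹ := fun k l hkl =>
      inv_anti₀ (hpos k) (hmono.monotone hkl)
    have h2 := sum_mul_quadraticForm_le he hTe hanti (fun k => (inv_pos.2 (hpos k)).le) hker
      ((orthonormal_stepVec hsym).comp σ σ.injective) (fun i j => hμ i j)
      (fun i => by rw [hσ]; exact Kmat_eigenvalues_nonneg hsym _)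
    rw [← Equiv.sum_comp σ, ← Equiv.sum_comp σ (fun l => hsym.eigenvalues l ^ 2)] at h1
    simp only [← hσ] at h1
    simp only [Function.comp_apply] at h2
    linarith
  · rw [intervalIntegral_sub_sq_eq]
    exact integral_sub_sq_le (by omega)
end
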